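/- Let K be an additive subgroup of ℝ. Then MTL_K and FO_K have the same expressive power if and only if K is dense. -/

import Mathlib

namespace MTLPaper

variable {K : AddSubgroup ℝ} {P : Type}

/-- `K ⊆ ℝ` is dense: between any two elements of `K` there is another element of `K`. -/
def DenseK (K : AddSubgroup ℝ) : Prop :=
  ∀ a ∈ K, ∀ b ∈ K, a < b → ∃ c ∈ K, a < c ∧ c < b

/-- A term of `FO_K`: a variable index together with a constant shift from `K`
(`(x, c)` denotes the term `x + c`; iterated shifts collapse since `K` is a group). -/
abbrev Term (K : AddSubgroup ℝ) : Type := ℕ × K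

/-- Value of a term under a valuation of the variables. -/
def Term.val (v : ℕ → ℝ) (t : Term K) : ℝ := v t.1 + (t.2 : ℝ)

/-- Formulas of the monadic logic of order and metric `FO_K`, over monadic predicates `P`. -/
inductive FO (K : AddSubgroup ℝ) (P : Type) : Type
  | tt : FO K P
  | atom : P → Term K → FO K P
  | lt : Term K → Term K → FO K P
  | conj : FO K P → FO K P → FO K P
  | neg : FO K P → FO K P
  | ex : ℕ → FO K P → FO K P

namespace FO

/-- Satisfaction of an `FO_K` formula over a signal `f` and a valuation `v`. -/
def sat (f : ℝ → Set P) : FO K P → (ℕ → ℝ) → Prop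
  | tt, _ => True
  | atom p t, v => p ∈ f (Term.val v t)
  | lt s t, v => Term.val v s < Term.val v t
  | conj φ ψ, v => sat f φ v ∧ sat f ψ v
  | neg φ, v => ¬ sat f φ v
  | ex x φ, v => ∃ r : ℝ, sat f φ (Function.update v x r)

/-- Free variables of an `FO_K` formula. -/
def free : FO K P → Set ℕ
  | tt => ∅
  | atom _ t => {t.1}
  | lt s t => {s.1, t.1}
  | conj φ ψ => free φ ∪ free ψ
  | neg φ => free φ
  | ex x φ => free φ \ {x}

/-- Quantifier depth. -/
def qdepth : FO K P → ℕ
  | tt => 0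
  | atom _ _ => 0
  | lt _ _ => 0
  | conj φ ψ => max (qdepth φ) (qdepth ψ)
  | neg φ => qdepth φ
  | ex _ φ => qdepth φ + 1

/-- Quantifier-free formulas. -/
def QFree : FO K P → Prop
  | tt => True
  | atom _ _ => True
  | lt _ _ => True
  | conj φ ψ => QFree φ ∧ QFree ψ
  | neg φ => QFree φ
  | ex _ _ => False

/-- `<`-free formulas. -/
def LtFree : FO K P → Prop
  | tt => True
  | atom _ _ => True
  | lt _ _ => False
  | conj φ ψ => LtFree φ ∧ LtFree ψ
  | neg φ => LtFree φ
  | ex _ φ => LtFree φ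

/-- Membership in `Bet_K(t₁,t₂)`: every quantified subformula `∃z ψ` has the form
`∃z ((t₁ < z < t₂) ∧ χ)`, and every monadic atom `P(t)` has `t` a bound occurrence of a
variable (no shift).  `B` records the set of variables bound so far. -/
def Bet (t₁ t₂ : Term K) : FO K P → Set ℕ → Prop
  | tt, _ => True
  | atom _ t, B => t.2 = (0 : K) ∧ t.1 ∈ B
  | lt _ _, _ => True
  | conj φ ψ, B => Bet t₁ t₂ φ B ∧ Bet t₁ t₂ ψ B
  | neg φ, B => Bet t₁ t₂ φ B
  | ex z (conj (conj (lt s u) (lt u' t)) χ), B =>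
      s = t₁ ∧ t = t₂ ∧ u = (z, (0 : K)) ∧ u' = (z, (0 : K)) ∧ Bet t₁ t₂ χ (insert z B)
  | ex _ _, _ => False

/-- `φ(x)` is `N`-bounded: it belongs to `Bet_K(x - N, x + N)`. -/
def NBounded (x : ℕ) (N : K) (φ : FO K P) : Prop :=
  Bet (x, -N) (x, N) φ (∅ : Set ℕ)

/-- The relativized quantifier `∃ y ∈ (s, t). φ`. -/
def guard (s t : Term K) (y : ℕ) (φ : FO K P) : FO K P :=
  ex y (conj (conj (lt s (y, (0 : K))) (lt (y, (0 : K)) t)) φ)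

/-- The guard interval of the body of a quantifier on `z`, if it has guarded shape. -/
def guardOf (z : ℕ) : FO K P → Set (Term K × Term K)
  | conj (conj (lt s u) (lt u' t)) _ =>
      {p | u = (z, (0 : K)) ∧ u' = (z, (0 : K)) ∧ p = (s, t)}
  | _ => ∅

/-- The guard intervals occurring in a formula. -/
def intervals : FO K P → Set (Term K × Term K)
  | tt => ∅
  | atom _ _ => ∅
  | lt _ _ => ∅
  | conj φ ψ => intervals φ ∪ intervals ψ
  | neg φ => intervals φ
  | ex z φ => guardOf z φ ∪ intervals φ

/-- Hierarchical Interval Formulas (HIFs).  Every `<`-free quantifier-free formula is a HIF;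
HIFs are closed under negation and disjunction (`φ ∨ ψ := ¬(¬φ ∧ ¬ψ)`); and if `φ(x̄, y)` is a
HIF such that the only guard intervals in `φ` involving `y` and a variable free in `φ` are of
the form `(x_l + c_l + c, y + c)` or `(y + c, x_r + c_r + c)` for some `c ∈ K`, then
`∃ y ∈ (x_l + c_l, x_r + c_r). φ` is a HIF. -/
inductive IsHIF : FO K P → Prop
  | base {φ : FO K P} : QFree φ → LtFree φ → IsHIF φ
  | negI {φ : FO K P} : IsHIF φ → IsHIF (neg φ)
  | disjI {φ ψ : FO K P} : IsHIF φ → IsHIF ψ → IsHIF (neg (conj (neg φ) (neg ψ)))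
  | exI {φ : FO K P} {y xl xr : ℕ} {cl cr : K} :
      IsHIF φ → xl ≠ y → xr ≠ y →
      (∀ s t : Term K, (s, t) ∈ intervals φ →
        (s.1 = y → t.1 ≠ y → t.1 ∈ free φ → ∃ c : K, s = (y, c) ∧ t = (xr, cr + c)) ∧
        (t.1 = y → s.1 ≠ y → s.1 ∈ free φ → ∃ c : K, t = (y, c) ∧ s = (xl, cl + c))) →
      IsHIF (guard (xl, cl) (xr, cr) y φ)

/-- A conjunction of constraints of the form `x_j + c < x_k + c'`. -/
def IsConstraintConj : FO K P → Prop
  | tt => True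
  | atom _ _ => False
  | lt _ _ => True
  | conj φ ψ => IsConstraintConj φ ∧ IsConstraintConj ψ
  | neg _ => False
  | ex _ _ => False

/-- The term `t` applies no nonzero shift unless its variable is `x`. -/
def TermOnly (x : ℕ) (t : Term K) : Prop := t.2 = (0 : K) ∨ t.1 = x

/-- The unary functions `+c` are applied only to the variable `x`. -/
def FnOnly (x : ℕ) : FO K P → Prop
  | tt => True
  | atom _ t => TermOnly x t
  | lt s t => TermOnly x s ∧ TermOnly x t
  | conj φ ψ => FnOnly x φ ∧ FnOnly x ψ
  | neg φ => FnOnly x φ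
  | ex _ φ => FnOnly x φ

end FO

/-- Equivalence of two `FO_K` formulas: same truth value for every signal and valuation. -/
def EquivFO (φ ψ : FO K P) : Prop :=
  ∀ (f : ℝ → Set P) (v : ℕ → ℝ), φ.sat f v ↔ ψ.sat f v

/-- An interval `I ⊆ (0,∞)` with endpoints in `K_{≥0} ∪ {∞}` (`hi = none` means `∞`). -/
structure MTLI (K : AddSubgroup ℝ) where
  lo : ℝ
  lo_mem : lo ∈ K
  lo_nonneg : 0 ≤ lo
  loClosed : Bool
  hi : Option ℝ
  hi_mem : ∀ h : ℝ, hi = some h → h ∈ K ∧ 0 ≤ h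
  hiClosed : Bool
  pos : lo = 0 → loClosed = false

namespace MTLI

/-- Membership in the interval. -/
def mem (I : MTLI K) (t : ℝ) : Prop :=
  (if I.loClosed then I.lo ≤ t else I.lo < t) ∧
  ∀ h : ℝ, I.hi = some h → (if I.hiClosed then t ≤ h else t < h)

/-- The interval is bounded. -/
def Bounded (I : MTLI K) : Prop := I.hi ≠ none

/-- The supremum of the interval, in `ℝ ∪ {∞}`. -/
def supW (I : MTLI K) : WithTop ℝ :=
  match I.hi with
  | none => ⊤
  | some h => (h : WithTop ℝ)

/-- The singleton (punctual) interval `{N}`, for `N ∈ K`, `N > 0`. -/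
def single (N : ℝ) (hm : N ∈ K) (h0 : 0 < N) : MTLI K where
  lo := N
  lo_mem := hm
  lo_nonneg := h0.le
  loClosed := true
  hi := some N
  hi_mem := fun h hh => by
    obtain rfl := (Option.some.inj hh).symm
    exact ⟨hm, h0.le⟩
  hiClosed := true
  pos := fun h => absurd h h0.ne'

/-- The unconstrained interval `(0, ∞)`. -/
def full : MTLI K where
  lo := 0
  lo_mem := zero_mem K
  lo_nonneg := le_refl 0
  loClosed := false
  hi := none
  hi_mem := fun _ hh => nomatch hh
  hiClosed := false
  pos := fun _ => rfl

end MTLI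

/-- Formulas of `MTL_K` over atomic propositions `P`. -/
inductive MTL (K : AddSubgroup ℝ) (P : Type) : Type
  | tt : MTL K P
  | atom : P → MTL K P
  | conj : MTL K P → MTL K P → MTL K P
  | neg : MTL K P → MTL K P
  | untl : MTL K P → MTL K P → MTLI K → MTL K P
  | sinc : MTL K P → MTL K P → MTLI K → MTL K P

namespace MTL

/-- Satisfaction of an `MTL_K` formula over a signal, at a point.
`untl φ ψ I` is `φ U_I ψ` and `sinc φ ψ I` is `φ S_I ψ`. -/
def sat (f : ℝ → Set P) : MTL K P → ℝ → Prop
  | tt, _ => True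
  | atom p, r => p ∈ f r
  | conj φ ψ, r => sat f φ r ∧ sat f ψ r
  | neg φ, r => ¬ sat f φ r
  | untl φ ψ I, r =>
      ∃ t : ℝ, r < t ∧ I.mem (t - r) ∧ sat f ψ t ∧ ∀ u, r < u → u < t → sat f φ u
  | sinc φ ψ I, r =>
      ∃ t : ℝ, t < r ∧ I.mem (r - t) ∧ sat f ψ t ∧ ∀ u, t < u → u < r → sat f φ u

/-- All intervals occurring in the temporal operators are bounded. -/
def AllBounded : MTL K P → Prop
  | tt => True
  | atom _ => True
  | conj φ ψ => AllBounded φ ∧ AllBounded ψ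
  | neg φ => AllBounded φ
  | untl φ ψ I => I.Bounded ∧ AllBounded φ ∧ AllBounded ψ
  | sinc φ ψ I => I.Bounded ∧ AllBounded φ ∧ AllBounded ψ

/-- LTL formulas: MTL formulas using only the interval `(0, ∞)`. -/
def IsLTL : MTL K P → Prop
  | tt => True
  | atom _ => True
  | conj φ ψ => IsLTL φ ∧ IsLTL ψ
  | neg φ => IsLTL φ
  | untl φ ψ I => I = MTLI.full ∧ IsLTL φ ∧ IsLTL ψ
  | sinc φ ψ I => I = MTLI.full ∧ IsLTL φ ∧ IsLTL ψ

/-- Future reach. -/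
noncomputable def fr : MTL K P → WithTop ℝ
  | tt => 0
  | atom _ => 0
  | conj φ ψ => max (fr φ) (fr ψ)
  | neg φ => fr φ
  | untl φ ψ I => I.supW + max (fr φ) (fr ψ)
  | sinc φ ψ I => max (fr φ) (WithTop.map (fun x => x - I.lo) (fr ψ))

/-- Past reach. -/
noncomputable def pr : MTL K P → WithTop ℝ
  | tt => 0
  | atom _ => 0
  | conj φ ψ => max (pr φ) (pr ψ)
  | neg φ => pr φ
  | untl φ ψ I => max (pr φ) (WithTop.map (fun x => x - I.lo) (pr ψ))
  | sinc φ ψ I => I.supW + max (pr φ) (pr ψ)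

/-- Boolean combinations of formulas from a class `S`. -/
inductive BC (S : MTL K P → Prop) : MTL K P → Prop
  | base {φ : MTL K P} : S φ → BC S φ
  | negB {φ : MTL K P} : BC S φ → BC S (neg φ)
  | conjB {φ ψ : MTL K P} : BC S φ → BC S ψ → BC S (conj φ ψ)

end MTL

/-- Equivalence of two `MTL_K` formulas. -/
def EquivMTL (φ ψ : MTL K P) : Prop :=
  ∀ (f : ℝ → Set P) (r : ℝ), φ.sat f r ↔ ψ.sat f r

/-- Equivalence of an `FO_K` formula with (at most) free variable `0` and an `MTL_K` formula. -/
def EquivFOMTL (φ : FO K P) (ψ : MTL K P) : Prop :=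
  ∀ (f : ℝ → Set P) (r : ℝ), φ.sat f (fun _ => r) ↔ ψ.sat f r

/-- `MTL_K` and `FO_K` have the same expressive power. -/
def SameExpressive (K : AddSubgroup ℝ) (P : Type) : Prop :=
  (∀ φ : FO K P, φ.free ⊆ {0} → ∃ ψ : MTL K P, EquivFOMTL φ ψ) ∧
  (∀ ψ : MTL K P, ∃ φ : FO K P, φ.free ⊆ {0} ∧ EquivFOMTL φ ψ)

/-- Formulas of `MTL_K` with counting modalities. -/
inductive MTLC (K : AddSubgroup ℝ) (P : Type) : Type
  | tt : MTLC K P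
  | atom : P → MTLC K P
  | conj : MTLC K P → MTLC K P → MTLC K P
  | neg : MTLC K P → MTLC K P
  | untl : MTLC K P → MTLC K P → MTLI K → MTLC K P
  | sinc : MTLC K P → MTLC K P → MTLI K → MTLC K P
  | fcount : ℕ → MTLC K P → MTLC K P
  | pcount : ℕ → MTLC K P → MTLC K P

namespace MTLC

/-- Satisfaction of an `MTL_K+C` formula. -/
def sat (f : ℝ → Set P) : MTLC K P → ℝ → Prop
  | tt, _ => True
  | atom p, r => p ∈ f r
  | conj φ ψ, r => sat f φ r ∧ sat f ψ r
  | neg φ, r => ¬ sat f φ r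
  | untl φ ψ I, r =>
      ∃ t : ℝ, r < t ∧ I.mem (t - r) ∧ sat f ψ t ∧ ∀ u, r < u → u < t → sat f φ u
  | sinc φ ψ I, r =>
      ∃ t : ℝ, t < r ∧ I.mem (r - t) ∧ sat f ψ t ∧ ∀ u, t < u → u < r → sat f φ u
  | fcount n φ, r =>
      ∃ s : Fin n → ℝ, StrictMono s ∧ ∀ i, s i ∈ Set.Ioo r (r + 1) ∧ sat f φ (s i)
  | pcount n φ, r =>
      ∃ s : Fin n → ℝ, StrictMono s ∧ ∀ i, s i ∈ Set.Ioo (r - 1) r ∧ sat f φ (s i)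

end MTLC

/-- The integers, as an additive subgroup of `ℝ`. -/
def intZ : AddSubgroup ℝ := AddSubgroup.zmultiples (1 : ℝ)

/-- Equivalence of an `FO_K` formula with free variable `0` and an `MTL_K+C` formula. -/
def EquivFOMTLC (φ : FO K P) (ψ : MTLC K P) : Prop :=
  ∀ (f : ℝ → Set P) (r : ℝ), φ.sat f (fun _ => r) ↔ ψ.sat f r

/-- Formulas of PQ2MLO: Q2MLO with punctuality. -/
inductive PQ (P : Type) : Type
  | tt : PQ P
  | atom : P → ℕ → PQ P
  | lt : ℕ → ℕ → PQ P
  | conj : PQ P → PQ P → PQ P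
  | neg : PQ P → PQ P
  | ex : ℕ → PQ P → PQ P
  | exFutI : ℕ → ℕ → PQ P → PQ P  -- ∃ y ∈ (x, x+1). ψ
  | exPastI : ℕ → ℕ → PQ P → PQ P -- ∃ y ∈ (x-1, x). ψ
  | exFutP : ℕ → ℕ → PQ P → PQ P  -- ∃ y (y = x+1 ∧ χ)
  | exPastP : ℕ → ℕ → PQ P → PQ P -- ∃ y (y = x-1 ∧ χ)

namespace PQ

/-- Satisfaction of a PQ2MLO formula. -/
def sat (f : ℝ → Set P) : PQ P → (ℕ → ℝ) → Prop
  | tt, _ => True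
  | atom p x, v => p ∈ f (v x)
  | lt x y, v => v x < v y
  | conj φ ψ, v => sat f φ v ∧ sat f ψ v
  | neg φ, v => ¬ sat f φ v
  | ex x φ, v => ∃ r : ℝ, sat f φ (Function.update v x r)
  | exFutI x y ψ, v => ∃ r : ℝ, v x < r ∧ r < v x + 1 ∧ sat f ψ (Function.update v y r)
  | exPastI x y ψ, v => ∃ r : ℝ, v x - 1 < r ∧ r < v x ∧ sat f ψ (Function.update v y r)
  | exFutP x y χ, v => ∃ r : ℝ, r = v x + 1 ∧ sat f χ (Function.update v y r)
  | exPastP x y χ, v => ∃ r : ℝ, r = v x - 1 ∧ sat f χ (Function.update v y r)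

/-- Free variables of a PQ2MLO formula. -/
def free : PQ P → Set ℕ
  | tt => ∅
  | atom _ x => {x}
  | lt x y => {x, y}
  | conj φ ψ => free φ ∪ free ψ
  | neg φ => free φ
  | ex x φ => free φ \ {x}
  | exFutI x y ψ => insert x (free ψ \ {y})
  | exPastI x y ψ => insert x (free ψ \ {y})
  | exFutP x y χ => insert x (free χ \ {y})
  | exPastP x y χ => insert x (free χ \ {y})

/-- Well-formedness: in `∃y∈(x,x+1) ψ` and `∃y∈(x-1,x) ψ` the formula `ψ` has exactly the
free variables `x` and `y`; in `∃y (y = x±1 ∧ χ)` the formula `χ` has exactly the free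
variable `y`. -/
def WF : PQ P → Prop
  | tt => True
  | atom _ _ => True
  | lt _ _ => True
  | conj φ ψ => WF φ ∧ WF ψ
  | neg φ => WF φ
  | ex _ φ => WF φ
  | exFutI x y ψ => x ≠ y ∧ free ψ = {x, y} ∧ WF ψ
  | exPastI x y ψ => x ≠ y ∧ free ψ = {x, y} ∧ WF ψ
  | exFutP x y χ => x ≠ y ∧ free χ = {y} ∧ WF χ
  | exPastP x y χ => x ≠ y ∧ free χ = {y} ∧ WF χ

end PQ

/-- Equivalence of an `FO_ℤ` formula with free variable `0` and a PQ2MLO formula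
with free variable `0`. -/
def EquivFOPQ (φ : FO intZ P) (π : PQ P) : Prop :=
  ∀ (f : ℝ → Set P) (r : ℝ), φ.sat f (fun _ => r) ↔ π.sat f (fun _ => r)

/-- Equivalence of a PQ2MLO formula with free variable `0` and an `MTL_ℤ+C` formula. -/
def EquivPQMTLC (π : PQ P) (ψ : MTLC intZ P) : Prop :=
  ∀ (f : ℝ → Set P) (r : ℝ), π.sat f (fun _ => r) ↔ ψ.sat f r

/-- The singleton interval `{1}` over the integer constants. -/
def oneI : MTLI intZ := MTLI.single 1 (AddSubgroup.mem_zmultiples (1 : ℝ)) one_pos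

/-- The interpretation of the enlarged set of monadic predicates: the predicate `(p, c)`
(i.e. `P^c`) holds at `r` iff `p` holds at `r + c`. -/
def liftSig (K : AddSubgroup ℝ) (f : ℝ → Set P) : ℝ → Set (P × K) :=
  fun r => {pc : P × K | pc.1 ∈ f (r + (pc.2 : ℝ))}

/-- Semantics of a decomposition formula `δ(x,y)`:
`x < y ∧ ∃ z₀ … zₙ (x = z₀ < ⋯ < zₙ = y) ∧ ⋀ φᵢ(zᵢ) ∧ ⋀ ∀u (z_{i-1} < u < z_i → ψᵢ(u))`,
where the `φᵢ`, `ψᵢ` are MTL formulas regarded as unary predicates. -/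
def DecompSat (f : ℝ → Set P) (n : ℕ) (φ ψ : ℕ → MTL K P) (x y : ℝ) : Prop :=
  x < y ∧ ∃ z : ℕ → ℝ, z 0 = x ∧ z n = y ∧ (∀ i < n, z i < z (i + 1)) ∧
    (∀ i, 0 < i → i < n → (φ i).sat f (z i)) ∧
    (∀ i, 0 < i → i ≤ n → ∀ u, z (i - 1) < u → u < z i → (ψ i).sat f u)

/-- Semantics of `δ(x,y)` for abstract unary predicates (no `x < y` conjunct). -/
def Delta (φ ψ : ℕ → ℝ → Prop) (n : ℕ) (x y : ℝ) : Prop :=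
  ∃ z : ℕ → ℝ, z 0 = x ∧ z n = y ∧ (∀ i < n, z i < z (i + 1)) ∧
    (∀ i, 0 < i → i < n → φ i (z i)) ∧
    (∀ i, 0 < i → i ≤ n → ∀ u, z (i - 1) < u → u < z i → ψ i u)

/-- Semantics of `δⱼ(x,y)`: the restriction of `δ` to the first `j` formulas of
`ψ₁, φ₁, ψ₂, φ₂, …, ψₙ`, with `k = ⌈j/2⌉` existential quantifiers after `z₀`. -/
def DeltaJ (φ ψ : ℕ → ℝ → Prop) (j : ℕ) (x y : ℝ) : Prop :=
  ∃ z : ℕ → ℝ, z 0 = x ∧ z ((j + 1) / 2) = y ∧ (∀ i < (j + 1) / 2, z i < z (i + 1)) ∧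
    (∀ i, 0 < i → i ≤ j / 2 → φ i (z i)) ∧
    (∀ i, 0 < i → i ≤ (j + 1) / 2 → ∀ u, z (i - 1) < u → u < z i → ψ i u)

/-- The three kinds of formulas in the separation lemma, for the constant `c`:
`◇_{{N}} θ` with `pr θ < N - c`; `◇⁻_{{N}} θ` with `fr θ < N - c`; and formulas in which
all intervals of temporal operators are bounded. -/
def SepKind (c : ℝ) (χ : MTL K P) : Prop :=
  (∃ (N : ℝ) (hm : N ∈ K) (h0 : 0 < N) (θ : MTL K P),
      χ = MTL.untl MTL.tt θ (MTLI.single N hm h0) ∧ θ.pr < ((N - c : ℝ) : WithTop ℝ)) ∨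
  (∃ (N : ℝ) (hm : N ∈ K) (h0 : 0 < N) (θ : MTL K P),
      χ = MTL.sinc MTL.tt θ (MTLI.single N hm h0) ∧ θ.fr < ((N - c : ℝ) : WithTop ℝ)) ∨
  χ.AllBounded


/-! ### Definable unary predicates -/

/-- `Q` is defined by some `MTL_K` formula. -/
def Definable (K : AddSubgroup ℝ) (Q : (ℝ → Set ℕ) → ℝ → Prop) : Prop :=
  ∃ ψ : MTL K ℕ, ∀ f r, Q f r ↔ ψ.sat f r

namespace Definable

variable {A B : (ℝ → Set ℕ) → ℝ → Prop}

theorem congr (hA : Definable K A) (h : ∀ f r, B f r ↔ A f r) : Definable K B := by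
  obtain ⟨a, ha⟩ := hA
  exact ⟨a, fun f r => (h f r).trans (ha f r)⟩

theorem not (hA : Definable K A) : Definable K fun f r => ¬ A f r := by
  obtain ⟨a, ha⟩ := hA
  exact ⟨.neg a, fun f r => by simp [MTL.sat, ha]⟩

theorem and (hA : Definable K A) (hB : Definable K B) :
    Definable K fun f r => A f r ∧ B f r := by
  obtain ⟨a, ha⟩ := hA
  obtain ⟨b, hb⟩ := hB
  exact ⟨.conj a b, fun f r => by simp [MTL.sat, ha, hb]⟩

theorem or (hA : Definable K A) (hB : Definable K B) :
    Definable K fun f r => A f r ∨ B f r :=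
  (hA.not.and hB.not).not.congr fun f r => by tauto

theorem const (p : Prop) : Definable K fun _ _ => p := by
  by_cases h : p
  · exact ⟨.tt, fun f r => by simp [MTL.sat, h]⟩
  · exact ⟨.neg .tt, fun f r => by simp [MTL.sat, h]⟩

theorem exists_mem {ι : Type*} {Q : ι → (ℝ → Set ℕ) → ℝ → Prop} (L : List ι)
    (h : ∀ i ∈ L, Definable K (Q i)) : Definable K fun f r => ∃ i ∈ L, Q i f r := by
  induction L with
  | nil => exact (const False).congr fun f r => by simp
  | cons i L ih =>
    exact ((h i (by simp)).or (ih fun j hj => h j (by simp [hj]))).congr fun f r => by simp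

theorem untl (hA : Definable K A) (hB : Definable K B) (I : MTLI K) :
    Definable K fun f r =>
      ∃ t, r < t ∧ I.mem (t - r) ∧ B f t ∧ ∀ u, r < u → u < t → A f u := by
  obtain ⟨a, ha⟩ := hA
  obtain ⟨b, hb⟩ := hB
  exact ⟨.untl a b I, fun f r => by simp [MTL.sat, ha, hb]⟩

theorem untl_full (hA : Definable K A) (hB : Definable K B) :
    Definable K fun f r => ∃ t, r < t ∧ B f t ∧ ∀ u, r < u → u < t → A f u :=
  (hA.untl hB MTLI.full).congr fun f r => by
    refine exists_congr fun t => and_congr_right fun h => ?_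
    simp [MTLI.mem, MTLI.full, h]

theorem untl_Ioo (hA : Definable K A) (hB : Definable K B) {p q : ℝ} (hp : p ∈ K) (hq : q ∈ K)
    (hp0 : 0 ≤ p) :
    Definable K fun f r =>
      ∃ t, r + p < t ∧ t < r + q ∧ B f t ∧ ∀ u, r < u → u < t → A f u := by
  by_cases hq0 : 0 ≤ q
  · refine (hA.untl hB ⟨p, hp, hp0, false, some q, fun h hh => ?_, false, fun _ => rfl⟩).congr
      fun f r => ?_
    · cases hh
      exact ⟨hq, hq0⟩
    · refine exists_congr fun t => ⟨?_, ?_⟩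
      · rintro ⟨h1, h2, h3⟩
        exact ⟨by linarith, ⟨by simp; linarith, by simp; linarith⟩, h3⟩
      · rintro ⟨h1, ⟨h2, h3⟩, h4⟩
        simp only [Bool.false_eq_true, if_false, Option.some.injEq, forall_eq'] at h2 h3
        exact ⟨by linarith, by linarith, h4⟩
  · refine (const False).congr fun f r => ?_
    simp only [iff_false, not_exists]
    rintro t ⟨h1, h2, -⟩
    linarith

theorem always_Ioo (hA : Definable K A) {p q : ℝ} (hp : p ∈ K) (hq : q ∈ K) (hp0 : 0 ≤ p) :
    Definable K fun f r => ∀ t, r + p < t → t < r + q → A f t :=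
  ((const True).untl_Ioo hA.not hp hq hp0).not.congr fun f r => by
    push Not
    simp

theorem shift (hA : Definable K A) {c : ℝ} (hc : c ∈ K) :
    Definable K fun f r => A f (r + c) := by
  obtain ⟨a, ha⟩ := hA
  rcases lt_trichotomy c 0 with h | rfl | h
  · refine ⟨.sinc .tt a (MTLI.single (-c) (neg_mem hc) (by linarith)), fun f r => ?_⟩
    simp only [MTL.sat, MTLI.mem, MTLI.single, ha]
    constructor
    · exact fun h' => ⟨r + c, by linarith, by simp, h', by simp⟩
    · rintro ⟨t, -, ⟨h1, h2⟩, h3, -⟩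
      simp only [if_true, Option.some.injEq, forall_eq'] at h1 h2
      rwa [show r + c = t by linarith]
  · simpa using ⟨a, ha⟩
  · refine ⟨.untl .tt a (MTLI.single c hc h), fun f r => ?_⟩
    simp only [MTL.sat, MTLI.mem, MTLI.single, ha]
    constructor
    · exact fun h' => ⟨r + c, by linarith, by simp, h', by simp⟩
    · rintro ⟨t, -, ⟨h1, h2⟩, h3, -⟩
      simp only [if_true, Option.some.injEq, forall_eq'] at h1 h2
      rwa [show r + c = t by linarith]

end Definable

/-- The time reversal of an `MTL` formula. -/
def MTL.rev : MTL K P → MTL K P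
  | .tt => .tt
  | .atom p => .atom p
  | .conj φ ψ => .conj φ.rev ψ.rev
  | .neg φ => .neg φ.rev
  | .untl φ ψ I => .sinc φ.rev ψ.rev I
  | .sinc φ ψ I => .untl φ.rev ψ.rev I

theorem forall_neg_Ioo {A : ℝ → Prop} {x y : ℝ} :
    (∀ u, x < u → u < y → A (-u)) ↔ ∀ u, -y < u → u < -x → A u :=
  ⟨fun h u h1 h2 => by simpa using h (-u) (by linarith) (by linarith),
    fun h u h1 h2 => h (-u) (by linarith) (by linarith)⟩

theorem MTL.sat_rev (f : ℝ → Set P) (φ : MTL K P) (r : ℝ) :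
    φ.rev.sat f r ↔ φ.sat (fun t => f (-t)) (-r) := by
  induction φ generalizing r with
  | tt => simp [MTL.rev, MTL.sat]
  | atom p => simp [MTL.rev, MTL.sat]
  | conj φ ψ h1 h2 => simp [MTL.rev, MTL.sat, h1, h2]
  | neg φ h => simp [MTL.rev, MTL.sat, h]
  | untl φ ψ I h1 h2 =>
    simp only [MTL.rev, MTL.sat, h1, h2]
    rw [← (Equiv.neg ℝ).exists_congr_right]
    refine exists_congr fun t => ?_
    simp only [Equiv.neg_apply, neg_neg, forall_neg_Ioo, sub_neg_eq_add]
    rw [neg_lt, add_comm]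
  | sinc φ ψ I h1 h2 =>
    simp only [MTL.rev, MTL.sat, h1, h2]
    rw [← (Equiv.neg ℝ).exists_congr_right]
    refine exists_congr fun t => ?_
    simp only [Equiv.neg_apply, neg_neg, forall_neg_Ioo]
    rw [lt_neg, show -t - r = -r - t by ring]

theorem Definable.rev {A : (ℝ → Set ℕ) → ℝ → Prop} (hA : Definable K A) :
    Definable K fun f r => A (fun t => f (-t)) (-r) := by
  obtain ⟨a, ha⟩ := hA
  exact ⟨a.rev, fun f r => (ha _ _).trans (MTL.sat_rev f a r).symm⟩

/-- A unary predicate together with its definability. -/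
structure UPred (K : AddSubgroup ℝ) where
  holds : (ℝ → Set ℕ) → ℝ → Prop
  definable : Definable K holds

namespace UPred

def top : UPred K := ⟨_, .const True⟩

def not (a : UPred K) : UPred K := ⟨_, a.definable.not⟩

def and (a b : UPred K) : UPred K := ⟨_, a.definable.and b.definable⟩

def or (a b : UPred K) : UPred K := ⟨_, a.definable.or b.definable⟩

def rev (a : UPred K) : UPred K := ⟨_, a.definable.rev⟩

def shift (c : K) (a : UPred K) : UPred K := ⟨_, a.definable.shift c.2⟩

/-- `a` holds at points arbitrarily close on the right. -/
def limRight (a : UPred K) : UPred K where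
  holds f x := ∀ w, x < w → ∃ u, x < u ∧ u < w ∧ a.holds f u
  definable := ((a.definable.not).untl_full (.const True)).not.congr fun f r => by
    push Not
    simp

end UPred

/-! ### Chains -/

/-- `last a b a'` describes a pair `x < y` with `a` at `x`, `b` on `(x, y)` and `a'` at `y`;
`cons a b c` asks for `a` at `x` and a point `z` between `x` and `y` such that `b` holds on
`(x, z)` and `(z, y)` is described by `c`. -/
inductive Chain (K : AddSubgroup ℝ) : Type
  | last : UPred K → UPred K → UPred K → Chain K
  | cons : UPred K → UPred K → Chain K → Chain K

namespace Chain

/-- The pair `x, y` is described by the chain, with all the intermediate points in `W`. -/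
def holds (W : ℝ → Prop) (f : ℝ → Set ℕ) : Chain K → ℝ → ℝ → Prop
  | last a b a', x, y =>
      a.holds f x ∧ (∀ u, x < u → u < y → b.holds f u) ∧ a'.holds f y
  | cons a b c, x, y =>
      a.holds f x ∧
        ∃ z, x < z ∧ z < y ∧ W z ∧ (∀ u, x < u → u < z → b.holds f u) ∧ holds W f c z y

/-- The pair `x, y` is described by the chain. -/
abbrev sat (f : ℝ → Set ℕ) (c : Chain K) (x y : ℝ) : Prop := c.holds (fun _ => True) f x y

/-- The number of intermediate points. -/
def length : Chain K → ℕ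
  | last _ _ _ => 0
  | cons _ _ c => c.length + 1

theorem holds_mono {V W : ℝ → Prop} {f : ℝ → Set ℕ} {c : Chain K} {x y : ℝ}
    (h : ∀ z, x < z → z < y → V z → W z) (hc : c.holds V f x y) : c.holds W f x y := by
  induction c generalizing x with
  | last a b a' => exact hc
  | cons a b c ih =>
    obtain ⟨h1, z, h2, h3, h4, h5, h6⟩ := hc
    exact ⟨h1, z, h2, h3, h z h2 h3 h4, h5, ih (fun w hw => h w (h2.trans hw)) h6⟩

theorem holds.sat {W : ℝ → Prop} {f : ℝ → Set ℕ} {c : Chain K} {x y : ℝ}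
    (hc : c.holds W f x y) : c.sat f x y :=
  holds_mono (fun _ _ _ _ => trivial) hc

/-- Strengthens the condition at the left endpoint. -/
def withHead (a : UPred K) : Chain K → Chain K
  | last a₀ b a' => last (a.and a₀) b a'
  | cons a₀ b c => cons (a.and a₀) b c

theorem holds_withHead {W : ℝ → Prop} {f : ℝ → Set ℕ} (a : UPred K) (c : Chain K) (x y : ℝ) :
    (c.withHead a).holds W f x y ↔ a.holds f x ∧ c.holds W f x y := by
  cases c <;> simp [withHead, holds, UPred.and, and_assoc]

@[simp]
theorem length_withHead (a : UPred K) (c : Chain K) : (c.withHead a).length = c.length := by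
  cases c <;> rfl

/-- Juxtaposition of two chains at an intermediate point. -/
def append : Chain K → Chain K → Chain K
  | last a b a', d => cons a b (d.withHead a')
  | cons a b c, d => cons a b (append c d)

theorem holds_append {W : ℝ → Prop} {f : ℝ → Set ℕ} (c d : Chain K) (x y : ℝ) :
    (c.append d).holds W f x y ↔
      ∃ z, x < z ∧ z < y ∧ W z ∧ c.holds W f x z ∧ d.holds W f z y := by
  induction c generalizing x with
  | last a b a' =>
    simp only [append, holds, holds_withHead]
    constructor
    · rintro ⟨h1, z, h2, h3, h4, h5, h6, h7⟩
      exact ⟨z, h2, h3, h4, ⟨h1, h5, h6⟩, h7⟩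
    · rintro ⟨z, h2, h3, h4, ⟨h1, h5, h6⟩, h7⟩
      exact ⟨h1, z, h2, h3, h4, h5, h6, h7⟩
  | cons a b c ih =>
    simp only [append, holds, ih]
    constructor
    · rintro ⟨h1, z, h2, h3, h4, h5, w, h6, h7, h8, h9, h10⟩
      exact ⟨w, h2.trans h6, h7, h8, ⟨h1, z, h2, h6, h4, h5, h9⟩, h10⟩
    · rintro ⟨w, h2, h3, h4, ⟨h1, z, h5, h6, h7, h8, h9⟩, h10⟩
      exact ⟨h1, z, h5, h6.trans h3, h7, h8, w, h6, h3, h4, h9, h10⟩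

theorem length_append (c d : Chain K) : (c.append d).length = c.length + d.length + 1 := by
  induction c with
  | last a b a' => simp [append, length]
  | cons a b c ih =>
    simp only [append, length, ih]
    omega

/-- The time reversal of a chain. -/
def rev : Chain K → Chain K
  | last a b a' => last a'.rev b.rev a.rev
  | cons a b c => (rev c).append (last .top b.rev a.rev)

theorem length_rev (c : Chain K) : c.rev.length = c.length := by
  induction c with
  | last a b a' => rfl
  | cons a b c ih => simp [rev, length_append, length, ih]

theorem holds_rev {W : ℝ → Prop} {f : ℝ → Set ℕ} (c : Chain K) (x y : ℝ) :
    c.rev.holds W f x y ↔ c.holds (fun t => W (-t)) (fun t => f (-t)) (-y) (-x) := by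
  induction c generalizing y with
  | last a b a' =>
    simp only [rev, holds, UPred.rev,
      forall_neg_Ioo (A := fun u => b.holds (fun t => f (-t)) u)]
    tauto
  | cons a b c ih =>
    simp only [rev, holds, holds_append, ih, UPred.rev, UPred.top,
      forall_neg_Ioo (A := fun u => b.holds (fun t => f (-t)) u)]
    constructor
    · rintro ⟨z, h1, h2, h3, h4, -, h5, h6⟩
      exact ⟨h6, -z, by linarith, by linarith, by simpa, h5, h4⟩
    · rintro ⟨h6, z, h1, h2, h3, h5, h4⟩
      exact ⟨-z, by linarith, by linarith, h3, by simpa, trivial, by simpa, h6⟩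

/-- The translate of a chain. -/
def shift (k : K) : Chain K → Chain K
  | last a b a' => last (a.shift k) (b.shift k) (a'.shift k)
  | cons a b c => cons (a.shift k) (b.shift k) (shift k c)

theorem sat_shift {f : ℝ → Set ℕ} (k : K) (c : Chain K) (x y : ℝ) :
    (c.shift k).sat f x y ↔ c.sat f (x + k) (y + k) := by
  have key : ∀ (b : UPred K) (x y : ℝ), (∀ u, x < u → u < y → b.holds f (u + k)) ↔
      ∀ u, x + k < u → u < y + k → b.holds f u := fun b x y =>
    ⟨fun h u h1 h2 => by simpa using h (u - k) (by linarith) (by linarith),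
      fun h u h1 h2 => h (u + k) (by linarith) (by linarith)⟩
  induction c generalizing x with
  | last a b a' => simp only [shift, sat, holds, UPred.shift, key]
  | cons a b c ih =>
    simp only [sat] at ih
    simp only [shift, sat, holds, UPred.shift, key, ih]
    refine and_congr_right fun _ => ?_
    conv_rhs => rw [← (Equiv.addRight (k : ℝ)).exists_congr_right]
    simp

/-- The ways in which a chain can be cut at a point. -/
def split : Chain K → List (Chain K × Chain K)
  | last a b a' => [(last a b b, last .top b a')]
  | cons a b c =>
      (last a b .top, c) :: (last a b b, cons .top b c) ::
        (split c).map fun p => (cons a b p.1, p.2)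

theorem length_le_of_mem_split {c : Chain K} {p : Chain K × Chain K} (hp : p ∈ c.split) :
    p.2.length ≤ c.length := by
  induction c generalizing p with
  | last a b a' =>
    simp only [split, List.mem_singleton] at hp
    simp [hp, length]
  | cons a b c ih =>
    simp only [split, List.mem_cons, List.mem_map] at hp
    rcases hp with rfl | rfl | ⟨q, hq, rfl⟩
    · simp [length]
    · simp [length]
    · exact (ih hq).trans (Nat.le_succ _)

theorem sat_of_mem_split {f : ℝ → Set ℕ} {c : Chain K} {p : Chain K × Chain K}
    (hp : p ∈ c.split) {x g y : ℝ} (hx : x < g) (hy : g < y) (h1 : p.1.sat f x g)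
    (h2 : p.2.sat f g y) : c.sat f x y := by
  have join : ∀ {b : UPred K} {x g y : ℝ}, (∀ u, x < u → u < g → b.holds f u) → b.holds f g →
      (∀ u, g < u → u < y → b.holds f u) → ∀ u, x < u → u < y → b.holds f u := by
    intro b x g y h1 h2 h3 u hu hu'
    rcases lt_trichotomy u g with h | rfl | h
    exacts [h1 u hu h, h2, h3 u h hu']
  induction c generalizing p x with
  | last a b a' =>
    simp only [split, List.mem_singleton] at hp
    subst hp
    exact ⟨h1.1, join h1.2.1 h1.2.2 h2.2.1, h2.2.2⟩
  | cons a b c ih =>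
    simp only [split, List.mem_cons, List.mem_map] at hp
    rcases hp with rfl | rfl | ⟨q, hq, rfl⟩
    · exact ⟨h1.1, g, hx, hy, trivial, h1.2.1, h2⟩
    · obtain ⟨-, z, h3, h4, -, h5, h6⟩ := h2
      exact ⟨h1.1, z, hx.trans h3, h4, trivial, join h1.2.1 h1.2.2 h5, h6⟩
    · obtain ⟨h3, z, h4, h5, -, h6, h7⟩ := h1
      exact ⟨h3, z, h4, h5.trans hy, trivial, h6, ih hq h5 h7 h2⟩

theorem exists_mem_split {f : ℝ → Set ℕ} {c : Chain K} {x g y : ℝ} (hx : x < g) (hy : g < y)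
    (h : c.sat f x y) : ∃ p ∈ c.split, p.1.sat f x g ∧ p.2.sat f g y := by
  induction c generalizing x with
  | last a b a' =>
    exact ⟨_, List.mem_singleton_self _, ⟨h.1, fun u h1 h2 => h.2.1 u h1 (h2.trans hy),
      h.2.1 g hx hy⟩, trivial, fun u h1 h2 => h.2.1 u (hx.trans h1) h2, h.2.2⟩
  | cons a b c ih =>
    obtain ⟨h1, z, h2, h3, -, h4, h5⟩ := h
    simp only [split, List.mem_cons, List.mem_map]
    rcases lt_trichotomy z g with hz | rfl | hz
    · obtain ⟨p, hp, h6, h7⟩ := ih hz h5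
      exact ⟨_, .inr (.inr ⟨p, hp, rfl⟩), ⟨h1, z, h2, hz, trivial, h4, h6⟩, h7⟩
    · exact ⟨_, .inl rfl, ⟨h1, h4, trivial⟩, h5⟩
    · exact ⟨_, .inr (.inl rfl), ⟨h1, fun u h6 h7 => h4 u h6 (h7.trans hz), h4 g hx hz⟩,
        trivial, z, hz, h3, trivial, fun u h6 h7 => h4 u (hx.trans h6) h7, h5⟩

end Chain

/-! ### Decomposable binary relations -/

/-- `R` is a finite disjunction of chains. -/
def Decomp (K : AddSubgroup ℝ) (R : (ℝ → Set ℕ) → ℝ → ℝ → Prop) : Prop :=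
  ∃ L : List (Chain K), ∀ f x y, x < y → (R f x y ↔ ∃ c ∈ L, c.sat f x y)

/-- `T f x z y` is a finite disjunction of conditions, each of which describes `x, z` by a chain
and `z, y` by a chain. -/
def Cut (K : AddSubgroup ℝ) (T : (ℝ → Set ℕ) → ℝ → ℝ → ℝ → Prop) : Prop :=
  ∃ L : List (Chain K × Chain K), ∀ f x z y, x < z → z < y →
    (T f x z y ↔ ∃ p ∈ L, p.1.sat f x z ∧ p.2.sat f z y)

namespace Decomp

variable {R S : (ℝ → Set ℕ) → ℝ → ℝ → Prop}

theorem congr (hR : Decomp K R) (h : ∀ f x y, x < y → (S f x y ↔ R f x y)) : Decomp K S := by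
  obtain ⟨L, hL⟩ := hR
  exact ⟨L, fun f x y hxy => (h f x y hxy).trans (hL f x y hxy)⟩

theorem of_chain (c : Chain K) : Decomp K fun f => c.sat f :=
  ⟨[c], fun f x y _ => by simp⟩

theorem false : Decomp K fun _ _ _ => False :=
  ⟨[], fun f x y _ => by simp⟩

theorem true : Decomp K fun _ _ _ => True :=
  (of_chain (.last .top .top .top)).congr fun f x y _ => by simp [Chain.holds, UPred.top]

theorem left (a : UPred K) : Decomp K fun f x _ => a.holds f x :=
  (of_chain (.last a .top .top)).congr fun f x y _ => by simp [Chain.holds, UPred.top]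

theorem right (a : UPred K) : Decomp K fun f _ y => a.holds f y :=
  (of_chain (.last .top .top a)).congr fun f x y _ => by simp [Chain.holds, UPred.top]

theorem seg (a : UPred K) : Decomp K fun f x y => ∀ u, x < u → u < y → a.holds f u :=
  (of_chain (.last .top a .top)).congr fun f x y _ => by simp [Chain.holds, UPred.top]

theorem or (hR : Decomp K R) (hS : Decomp K S) : Decomp K fun f x y => R f x y ∨ S f x y := by
  obtain ⟨L, hL⟩ := hR
  obtain ⟨M, hM⟩ := hS
  refine ⟨L ++ M, fun f x y h => ?_⟩
  simp only [List.mem_append, or_and_right, exists_or, hL f x y h, hM f x y h]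

theorem exists_mem {ι : Type*} {R : ι → (ℝ → Set ℕ) → ℝ → ℝ → Prop} (L : List ι)
    (h : ∀ i ∈ L, Decomp K (R i)) : Decomp K fun f x y => ∃ i ∈ L, R i f x y := by
  induction L with
  | nil => exact false.congr fun f x y _ => by simp
  | cons i L ih =>
    exact ((h i (by simp)).or (ih fun j hj => h j (by simp [hj]))).congr fun f x y _ => by simp

theorem comp (hR : Decomp K R) (hS : Decomp K S) :
    Decomp K fun f x y => ∃ z, x < z ∧ z < y ∧ R f x z ∧ S f z y := by
  obtain ⟨L, hL⟩ := hR
  obtain ⟨M, hM⟩ := hS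
  refine (exists_mem L fun c _ => exists_mem M fun d _ => of_chain (c.append d)).congr
    fun f x y _ => ?_
  simp only [Chain.sat, Chain.holds_append, true_and]
  constructor
  · rintro ⟨z, h1, h2, h3, h4⟩
    obtain ⟨c, hc, h3⟩ := (hL f x z h1).1 h3
    obtain ⟨d, hd, h4⟩ := (hM f z y h2).1 h4
    exact ⟨c, hc, d, hd, z, h1, h2, h3, h4⟩
  · rintro ⟨c, hc, d, hd, z, h1, h2, h3, h4⟩
    exact ⟨z, h1, h2, (hL f x z h1).2 ⟨c, hc, h3⟩, (hM f z y h2).2 ⟨d, hd, h4⟩⟩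

theorem rev (hR : Decomp K R) : Decomp K fun f x y => R (fun t => f (-t)) (-y) (-x) := by
  obtain ⟨L, hL⟩ := hR
  refine (exists_mem L fun c _ => of_chain c.rev).congr fun f x y h => ?_
  simp only [Chain.sat, Chain.holds_rev]
  exact hL _ _ _ (by linarith)

theorem shift (hR : Decomp K R) (k : K) : Decomp K fun f x y => R f (x + k) (y + k) := by
  obtain ⟨L, hL⟩ := hR
  refine (exists_mem L fun c _ => of_chain (c.shift k)).congr fun f x y h => ?_
  simp only [Chain.sat_shift]
  exact hL _ _ _ (by linarith)

theorem cut (hR : Decomp K R) : Cut K fun f x _ y => R f x y := by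
  obtain ⟨L, hL⟩ := hR
  refine ⟨L.flatMap Chain.split, fun f x z y h1 h2 => ?_⟩
  refine (hL f x y (h1.trans h2)).trans ⟨?_, ?_⟩
  · rintro ⟨c, hc, h⟩
    obtain ⟨p, hp, h⟩ := Chain.exists_mem_split h1 h2 h
    exact ⟨p, List.mem_flatMap.2 ⟨c, hc, hp⟩, h⟩
  · rintro ⟨p, hp, h3, h4⟩
    obtain ⟨c, hc, hp⟩ := List.mem_flatMap.1 hp
    exact ⟨c, hc, Chain.sat_of_mem_split hp h1 h2 h3 h4⟩

theorem last_and_chain (a b a' : UPred K) (c : Chain K) :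
    Decomp K fun f x y => (Chain.last a b a').sat f x y ∧ c.sat f x y := by
  induction c generalizing a with
  | last d e d' =>
    refine (of_chain (.last (a.and d) (b.and e) (a'.and d'))).congr fun f x y _ => ?_
    simp only [Chain.sat, Chain.holds, UPred.and]
    constructor
    · rintro ⟨⟨h1, h2, h3⟩, h4, h5, h6⟩
      exact ⟨⟨h1, h4⟩, fun u hu hu' => ⟨h2 u hu hu', h5 u hu hu'⟩, h3, h6⟩
    · rintro ⟨⟨h1, h4⟩, h2, h3, h6⟩
      exact ⟨⟨h1, fun u hu hu' => (h2 u hu hu').1, h3⟩, h4, fun u hu hu' => (h2 u hu hu').2, h6⟩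
  | cons d e c ih =>
    refine ((of_chain (.last (a.and d) (b.and e) b)).comp (ih b)).congr fun f x y _ => ?_
    simp only [Chain.sat, Chain.holds, UPred.and]
    constructor
    · rintro ⟨⟨h1, h2, h3⟩, h4, z, h5, h6, -, h7, h8⟩
      have hz := h2 z h5 h6
      exact ⟨z, h5, h6, ⟨⟨h1, h4⟩, fun u hu hu' => ⟨h2 u hu (hu'.trans h6), h7 u hu hu'⟩, hz⟩,
        ⟨hz, fun u hu => h2 u (h5.trans hu), h3⟩, h8⟩
    · rintro ⟨z, h5, h6, ⟨⟨h1, h4⟩, h7, hz⟩, ⟨-, h2, h3⟩, h8⟩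
      refine ⟨⟨h1, fun u hu hu' => ?_, h3⟩, h4, z, h5, h6, trivial,
        fun u hu hu' => (h7 u hu hu').2, h8⟩
      rcases lt_trichotomy u z with h | rfl | h
      exacts [(h7 u hu h).1, hz, h2 u h hu']

theorem chain_and (c : Chain K) (hR : Decomp K R) :
    Decomp K fun f x y => c.sat f x y ∧ R f x y := by
  induction c generalizing R with
  | last a b a' =>
    obtain ⟨L, hL⟩ := hR
    refine (exists_mem L fun c _ => last_and_chain a b a' c).congr fun f x y h => ?_
    rw [hL f x y h]
    simp only [← exists_and_left]
    exact exists_congr fun _ => and_left_comm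
  | cons a b c ih =>
    obtain ⟨L, hL⟩ := hR.cut
    refine (exists_mem L fun p _ =>
      (last_and_chain a b .top p.1).comp (ih (of_chain p.2))).congr fun f x y _ => ?_
    simp only [Chain.sat, Chain.holds, UPred.top]
    constructor
    · rintro ⟨⟨h1, z, h2, h3, -, h4, h5⟩, h6⟩
      obtain ⟨p, hp, h7, h8⟩ := (hL f x z y h2 h3).1 h6
      exact ⟨p, hp, z, h2, h3, ⟨⟨h1, h4, trivial⟩, h7⟩, h5, h8⟩
    · rintro ⟨p, hp, z, h2, h3, ⟨⟨h1, h4, -⟩, h7⟩, h5, h8⟩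
      exact ⟨⟨h1, z, h2, h3, trivial, h4, h5⟩, (hL f x z y h2 h3).2 ⟨p, hp, h7, h8⟩⟩

theorem and (hR : Decomp K R) (hS : Decomp K S) : Decomp K fun f x y => R f x y ∧ S f x y := by
  obtain ⟨L, hL⟩ := hR
  refine (exists_mem L fun c _ => chain_and c hS).congr fun f x y h => ?_
  rw [hL f x y h]
  simp only [← exists_and_right, and_assoc]

theorem forall_mem {ι : Type*} {R : ι → (ℝ → Set ℕ) → ℝ → ℝ → Prop} (L : List ι)
    (h : ∀ i ∈ L, Decomp K (R i)) : Decomp K fun f x y => ∀ i ∈ L, R i f x y := by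
  induction L with
  | nil => exact true.congr fun f x y _ => by simp
  | cons i L ih =>
    exact ((h i (by simp)).and (ih fun j hj => h j (by simp [hj]))).congr fun f x y _ => by simp

end Decomp

namespace Cut

variable {T U : (ℝ → Set ℕ) → ℝ → ℝ → ℝ → Prop}

theorem congr (hT : Cut K T) (h : ∀ f x z y, x < z → z < y → (U f x z y ↔ T f x z y)) :
    Cut K U := by
  obtain ⟨L, hL⟩ := hT
  exact ⟨L, fun f x z y h1 h2 => (h f x z y h1 h2).trans (hL f x z y h1 h2)⟩

theorem or (hT : Cut K T) (hU : Cut K U) : Cut K fun f x z y => T f x z y ∨ U f x z y := by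
  obtain ⟨L, hL⟩ := hT
  obtain ⟨M, hM⟩ := hU
  refine ⟨L ++ M, fun f x z y h1 h2 => ?_⟩
  simp only [List.mem_append, or_and_right, exists_or, hL f x z y h1 h2, hM f x z y h1 h2]

theorem exists_mem {ι : Type*} {T : ι → (ℝ → Set ℕ) → ℝ → ℝ → ℝ → Prop} (L : List ι)
    (h : ∀ i ∈ L, Cut K (T i)) : Cut K fun f x z y => ∃ i ∈ L, T i f x z y := by
  induction L with
  | nil => exact ⟨[], fun f x z y _ _ => by simp⟩
  | cons i L ih =>
    exact ((h i (by simp)).or (ih fun j hj => h j (by simp [hj]))).congr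
      fun f x z y _ _ => by simp

theorem prod {R S : (ℝ → Set ℕ) → ℝ → ℝ → Prop} (hR : Decomp K R) (hS : Decomp K S) :
    Cut K fun f x z y => R f x z ∧ S f z y := by
  obtain ⟨L, hL⟩ := hR
  obtain ⟨M, hM⟩ := hS
  refine (exists_mem L fun c _ => exists_mem M fun d _ =>
    (⟨[(c, d)], fun f x z y _ _ => by simp⟩ :
      Cut K fun f x z y => c.sat f x z ∧ d.sat f z y)).congr fun f x z y h1 h2 => ?_
  rw [hL f x z h1, hM f z y h2]
  constructor
  · rintro ⟨⟨c, hc, h3⟩, d, hd, h4⟩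
    exact ⟨c, hc, d, hd, h3, h4⟩
  · rintro ⟨c, hc, d, hd, h3, h4⟩
    exact ⟨⟨c, hc, h3⟩, d, hd, h4⟩

theorem and (hT : Cut K T) (hU : Cut K U) : Cut K fun f x z y => T f x z y ∧ U f x z y := by
  obtain ⟨L, hL⟩ := hT
  obtain ⟨M, hM⟩ := hU
  refine (exists_mem L fun p _ => exists_mem M fun q _ =>
    prod ((Decomp.of_chain p.1).and (.of_chain q.1))
      ((Decomp.of_chain p.2).and (.of_chain q.2))).congr fun f x z y h1 h2 => ?_
  rw [hL f x z y h1 h2, hM f x z y h1 h2]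
  constructor
  · rintro ⟨⟨p, hp, h3, h4⟩, q, hq, h5, h6⟩
    exact ⟨p, hp, q, hq, ⟨h3, h5⟩, h4, h6⟩
  · rintro ⟨p, hp, q, hq, ⟨h3, h5⟩, h4, h6⟩
    exact ⟨⟨p, hp, h3, h4⟩, q, hq, h5, h6⟩

theorem forall_mem {ι : Type*} {T : ι → (ℝ → Set ℕ) → ℝ → ℝ → ℝ → Prop} (L : List ι)
    (h : ∀ i ∈ L, Cut K (T i)) : Cut K fun f x z y => ∀ i ∈ L, T i f x z y := by
  induction L with
  | nil => exact (prod .true .true).congr fun f x z y _ _ => by simp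
  | cons i L ih =>
    exact ((h i (by simp)).and (ih fun j hj => h j (by simp [hj]))).congr
      fun f x z y _ _ => by simp

theorem exists_between (hT : Cut K T) :
    Decomp K fun f x y => ∃ z, x < z ∧ z < y ∧ T f x z y := by
  obtain ⟨L, hL⟩ := hT
  refine (Decomp.exists_mem L fun p _ =>
    (Decomp.of_chain p.1).comp (.of_chain p.2)).congr fun f x y _ => ?_
  constructor
  · rintro ⟨z, h1, h2, h3⟩
    obtain ⟨p, hp, h3⟩ := (hL f x z y h1 h2).1 h3
    exact ⟨p, hp, z, h1, h2, h3⟩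
  · rintro ⟨p, hp, z, h1, h2, h3⟩
    exact ⟨z, h1, h2, (hL f x z y h1 h2).2 ⟨p, hp, h3⟩⟩

end Cut

/-! ### Negation of decomposable relations -/

/-- If `Q` holds somewhere in `(x, y)`, then either `x` is a right limit of points of `Q`, or there
is a first point of `(x, y)` that belongs to `Q` or is a right limit of points of `Q`. -/
theorem exists_first {Q : ℝ → Prop} {x y u : ℝ} (hx : x < u) (hy : u < y) (hu : Q u) :
    (∀ w, x < w → ∃ u, x < u ∧ u < w ∧ Q u) ∨
      ∃ g, x < g ∧ g < y ∧ (∀ u, x < u → u < g → ¬ Q u) ∧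
        (Q g ∨ ∀ w, g < w → ∃ u, g < u ∧ u < w ∧ Q u) := by
  set s : Set ℝ := {u | x < u ∧ Q u}
  have hs : s.Nonempty := ⟨u, hx, hu⟩
  have hb : BddBelow s := ⟨x, fun v hv => hv.1.le⟩
  have hlt : ∀ w, sInf s < w → ∃ u, x < u ∧ u < w ∧ Q u := fun w hw => by
    obtain ⟨v, hv, hvw⟩ := exists_lt_of_csInf_lt hs hw
    exact ⟨v, hv.1, hvw, hv.2⟩
  rcases (le_csInf hs fun v hv => hv.1.le : x ≤ sInf s).eq_or_lt with h | h
  · rw [← h] at hlt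
    exact .inl hlt
  · refine .inr ⟨sInf s, h, (csInf_le hb ⟨hx, hu⟩).trans_lt hy,
      fun v h1 h2 h3 => (csInf_le hb ⟨h1, h3⟩).not_gt h2, ?_⟩
    by_cases hQ : Q (sInf s)
    · exact .inl hQ
    · refine .inr fun w hw => ?_
      obtain ⟨v, h1, h2, h3⟩ := hlt w hw
      refine ⟨v, lt_of_le_of_ne (csInf_le hb ⟨h1, h3⟩) ?_, h2, h3⟩
      rintro rfl
      exact hQ h3

/-- The predicates in the list hold at the successive points of an increasing sequence
in `(x, y)`. -/
def Increasing (f : ℝ → Set ℕ) : List (UPred K) → ℝ → ℝ → Prop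
  | [], _, _ => True
  | p :: l, x, y => ∃ z, x < z ∧ z < y ∧ p.holds f z ∧ Increasing f l z y

namespace Increasing

variable {f : ℝ → Set ℕ}

theorem anti {l : List (UPred K)} {x x' y : ℝ} (hx : x' ≤ x) (h : Increasing f l x y) :
    Increasing f l x' y := by
  cases l with
  | nil => trivial
  | cons p l =>
    obtain ⟨z, h1, h2⟩ := h
    exact ⟨z, hx.trans_lt h1, h2⟩

theorem eventually {l : List (UPred K)} {x y : ℝ} (hxy : x < y) (h : Increasing f l x y) :
    ∃ w, x < w ∧ w ≤ y ∧ ∀ z, z < w → Increasing f l z y := by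
  cases l with
  | nil => exact ⟨y, hxy, le_rfl, fun _ _ => trivial⟩
  | cons p l =>
    obtain ⟨z, h1, h2, h3⟩ := h
    exact ⟨z, h1, h2.le, fun w hw => ⟨z, hw, h2, h3⟩⟩

theorem decomp_not (l : List (UPred K)) : Decomp K fun f x y => ¬ Increasing f l x y := by
  induction l with
  | nil => exact Decomp.false.congr fun f x y _ => by simp [Increasing]
  | cons p l ih =>
    refine ((Decomp.seg p.not).or (((Decomp.left p.limRight).and ih).or
      (((Decomp.seg p.not).and (.right (p.or p.limRight))).comp ih))).congr fun f x y hxy => ?_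
    simp only [UPred.not, UPred.or]
    constructor
    · intro h
      refine or_iff_not_imp_left.2 fun h1 => ?_
      push Not at h1
      obtain ⟨u, hu, hu', hpu⟩ := h1
      rcases exists_first hu hu' hpu with h2 | ⟨g, h2, h3, h4, h5⟩
      · refine .inl ⟨h2, fun h3 => h ?_⟩
        obtain ⟨w, hw, hwy, h4⟩ := h3.eventually hxy
        obtain ⟨v, hv, hvw, hpv⟩ := h2 w hw
        exact ⟨v, hv, hvw.trans_le hwy, hpv, h4 v hvw⟩
      · refine .inr ⟨g, h2, h3, ⟨h4, h5⟩, fun h6 => h ?_⟩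
        rcases h5 with h5 | h5
        · exact ⟨g, h2, h3, h5, h6⟩
        · obtain ⟨w, hw, hwy, h7⟩ := h6.eventually h3
          obtain ⟨v, hv, hvw, hpv⟩ := h5 w hw
          exact ⟨v, h2.trans hv, hvw.trans_le hwy, hpv, h7 v hvw⟩
    · rintro h ⟨z, h1, h2, h3, h4⟩
      rcases h with h | ⟨-, h⟩ | ⟨g, -, -, ⟨h, -⟩, h'⟩
      · exact h z h1 h2 h3
      · exact h (h4.anti h1.le)
      · exact h' (h4.anti (not_lt.1 fun hz => h z h1 hz h3))

end Increasing

namespace Chain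

/-- The chain describes `x, y` for some `y > x`. -/
def future : Chain K → UPred K
  | last a b a' => ⟨_, a.definable.and (b.definable.untl_full a'.definable)⟩
  | cons a b c => ⟨_, a.definable.and (b.definable.untl_full c.future.definable)⟩

theorem future_iff {f : ℝ → Set ℕ} (c : Chain K) (x : ℝ) :
    c.future.holds f x ↔ ∃ y, x < y ∧ c.sat f x y := by
  induction c generalizing x with
  | last a b a' =>
    simp only [future, sat, holds]
    constructor
    · rintro ⟨h1, y, h2, h3, h4⟩
      exact ⟨y, h2, h1, h4, h3⟩
    · rintro ⟨y, h2, h1, h4, h3⟩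
      exact ⟨h1, y, h2, h3, h4⟩
  | cons a b c ih =>
    simp only [future, sat, holds, ih]
    constructor
    · rintro ⟨h1, z, h2, ⟨y, h3, h4⟩, h5⟩
      exact ⟨y, h2.trans h3, h1, z, h2, h3, trivial, h5, h4⟩
    · rintro ⟨y, h2, h1, z, h3, h4, -, h5, h6⟩
      exact ⟨h1, z, h3, ⟨y, h4, h6⟩, h5⟩

/-- The predicates to be met in turn by a chain whose right endpoint is not prescribed. -/
def futures : Chain K → List (UPred K)
  | last _ _ a' => [a']
  | cons _ _ c => c.future :: c.futures

theorem exists_sat_before_iff {f : ℝ → Set ℕ} (c : Chain K) (x y : ℝ) :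
    (∃ z, x < z ∧ z < y ∧ c.sat f x z) ↔
      c.future.holds f x ∧ Increasing f c.futures x y := by
  induction c generalizing x with
  | last a b a' =>
    simp only [future, futures, Increasing, sat, holds]
    constructor
    · rintro ⟨z, h1, h2, h3, h4, h5⟩
      exact ⟨⟨h3, z, h1, h5, h4⟩, z, h1, h2, h5, trivial⟩
    · rintro ⟨⟨h1, z, h2, h3, h4⟩, w, h5, h6, h7, -⟩
      rcases le_total z w with h | h
      · exact ⟨z, h2, h.trans_lt h6, h1, h4, h3⟩
      · exact ⟨w, h5, h6, h1, fun u hu hu' => h4 u hu (hu'.trans_le h), h7⟩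
  | cons a b c ih =>
    simp only [futures, Increasing]
    constructor
    · rintro ⟨z, h1, h2, h3, w, h4, h5, -, h6, h7⟩
      obtain ⟨h8, h9⟩ := (ih w).1 ⟨z, h5, h2, h7⟩
      exact ⟨⟨h3, w, h4, h8, h6⟩, w, h4, h5.trans h2, h8, h9⟩
    · rintro ⟨⟨h1, z, h2, h3, h4⟩, w, h5, h6, h7, h8⟩
      rcases le_total z w with h | h
      · obtain ⟨v, h9, h10, h11⟩ := (ih z).2 ⟨h3, h8.anti h⟩
        exact ⟨v, h2.trans h9, h10, h1, z, h2, h9, trivial, h4, h11⟩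
      · obtain ⟨v, h9, h10, h11⟩ := (ih w).2 ⟨h7, h8⟩
        exact ⟨v, h5.trans h9, h10, h1, w, h5, h9, trivial,
          fun u hu hu' => h4 u hu (hu'.trans_le h), h11⟩

end Chain

namespace Decomp

variable {R S : (ℝ → Set ℕ) → ℝ → ℝ → Prop}

theorem not_exists_before (hR : Decomp K R) :
    Decomp K fun f x y => ¬ ∃ z, x < z ∧ z < y ∧ R f x z := by
  obtain ⟨L, hL⟩ := hR
  refine (forall_mem L fun c _ => (left c.future.not).or
    (Increasing.decomp_not c.futures)).congr fun f x y _ => ?_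
  simp only [UPred.not, ← not_and_or, ← Chain.exists_sat_before_iff]
  push Not
  constructor
  · intro h c hc z h1 h2 h3
    exact h z h1 h2 ((hL f x z h1).2 ⟨c, hc, h3⟩)
  · intro h z h1 h2 h3
    obtain ⟨c, hc, h3⟩ := (hL f x z h1).1 h3
    exact h c hc z h1 h2 h3

theorem not_exists_after (hR : Decomp K R) :
    Decomp K fun f x y => ¬ ∃ z, x < z ∧ z < y ∧ R f z y :=
  hR.rev.not_exists_before.rev.congr fun f x y _ => by
    rw [← (Equiv.neg ℝ).exists_congr_right]
    simp only [Equiv.neg_apply, neg_neg]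
    refine not_congr (exists_congr fun z => ?_)
    rw [lt_neg, neg_lt, ← and_assoc, ← and_assoc, and_comm (a := z < -x)]

theorem not_chain (c : Chain K) : Decomp K fun f x y => ¬ c.sat f x y := by
  induction hn : c.length using Nat.strong_induction_on generalizing c with
  | _ n ih =>
  cases c with
  | last a b a' =>
    refine ((left a.not).or ((right a'.not).or
      ((right b.not).comp (true)))).congr fun f x y _ => ?_
    simp only [UPred.not, Chain.sat, Chain.holds, not_and_or, and_true]
    push Not
    exact or_congr_right or_comm
  | cons a b c =>
    simp only [Chain.length] at hn
    have hlen : ∀ p ∈ c.split, p.2.length < n := fun p hp => by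
      have := Chain.length_le_of_mem_split hp
      omega
    have hcut : Cut K fun f x g y => ¬ ∃ z, x < z ∧ z < g ∧ c.sat f z y := by
      refine (Cut.forall_mem c.split fun p hp =>
        (Cut.prod (of_chain p.1).not_exists_after true).or
          (Cut.prod true (ih _ (hlen p hp) p.2 rfl))).congr fun f x g y hx hy => ?_
      simp only [and_true, true_and]
      constructor
      · refine fun h p hp => or_iff_not_imp_right.2 fun h1 ⟨z, h2, h3, h4⟩ => h ?_
        exact ⟨z, h2, h3, Chain.sat_of_mem_split hp h3 hy h4 (not_not.1 h1)⟩
      · rintro h ⟨z, h1, h2, h3⟩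
        obtain ⟨p, hp, h4, h5⟩ := Chain.exists_mem_split h2 hy h3
        exact (h p hp).elim (fun h => h ⟨z, h1, h2, h4⟩) fun h => h h5
    refine ((left a.not).or ((left b.not.limRight).or
      (((seg b).and (of_chain c).not_exists_after).or
        (((Cut.prod ((seg b).and (right (b.not.or b.not.limRight)))
          (ih _ (by omega) c rfl)).and hcut).exists_between)))).congr fun f x y hxy => ?_
    simp only [UPred.not, UPred.or]
    constructor
    · intro h
      refine or_iff_not_imp_left.2 fun ha => or_iff_not_imp_left.2 fun h1 => ?_
      have h' : ∀ z, x < z → z < y → (∀ u, x < u → u < z → b.holds f u) → ¬ c.sat f z y :=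
        fun z hz hz' hb hc => h ⟨not_not.1 ha, z, hz, hz', trivial, hb, hc⟩
      by_cases h2 : ∀ u, x < u → u < y → b.holds f u
      · exact .inl ⟨h2, fun ⟨z, h3, h4, h5⟩ => h' z h3 h4 (fun u hu hu' => h2 u hu (hu'.trans h4)) h5⟩
      · push Not at h2
        obtain ⟨u, hu, hu', hbu⟩ := h2
        obtain ⟨g, h3, h4, h5, h6⟩ :=
          (exists_first (Q := fun u => ¬ b.holds f u) hu hu' hbu).resolve_left h1
        simp only [not_not] at h5
        exact .inr ⟨g, h3, h4, ⟨⟨h5, h6⟩, h' g h3 h4 h5⟩, fun ⟨z, h7, h8, h9⟩ =>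
          h' z h7 (h8.trans h4) (fun u hu hu' => h5 u hu (hu'.trans h8)) h9⟩
    · rintro h ⟨h1, z, h2, h3, -, h4, h5⟩
      rcases h with h | h | ⟨-, h⟩ | ⟨g, h6, h7, ⟨⟨h8, h9⟩, h10⟩, h11⟩
      · exact h h1
      · obtain ⟨u, hu, hu', hbu⟩ := h z h2
        exact hbu (h4 u hu hu')
      · exact h ⟨z, h2, h3, h5⟩
      · rcases lt_trichotomy z g with hz | rfl | hz
        · exact h11 ⟨z, h2, hz, h5⟩
        · exact h10 h5
        · rcases h9 with h9 | h9
          · exact h9 (h4 g h6 hz)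
          · obtain ⟨u, hu, hu', hbu⟩ := h9 z hz
            exact hbu (h4 u (h6.trans hu) hu')

theorem not (hR : Decomp K R) : Decomp K fun f x y => ¬ R f x y := by
  obtain ⟨L, hL⟩ := hR
  refine (forall_mem L fun c _ => not_chain c).congr fun f x y h => ?_
  rw [hL f x y h]
  push Not
  rfl

theorem definable_exists_after (hR : Decomp K R) :
    Definable K fun f x => ∃ y, x < y ∧ R f x y := by
  obtain ⟨L, hL⟩ := hR
  refine (Definable.exists_mem L fun c _ => c.future.definable).congr fun f x => ?_
  simp only [Chain.future_iff]
  constructor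
  · rintro ⟨y, h1, h2⟩
    obtain ⟨c, hc, h2⟩ := (hL f x y h1).1 h2
    exact ⟨c, hc, y, h1, h2⟩
  · rintro ⟨c, hc, y, h1, h2⟩
    exact ⟨y, h1, (hL f x y h1).2 ⟨c, hc, h2⟩⟩

theorem definable_exists_before (hR : Decomp K R) :
    Definable K fun f y => ∃ x, x < y ∧ R f x y :=
  hR.rev.definable_exists_after.rev.congr fun f x => by
    rw [← (Equiv.neg ℝ).exists_congr_right]
    simp only [Equiv.neg_apply, neg_neg]
    exact exists_congr fun y => by rw [neg_lt]

end Decomp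

/-! ### Chains of a fixed length -/

theorem DenseK.exists_small (hK : DenseK K) {d : ℝ} (hd : d ∈ K) (hd0 : 0 < d) (n : ℕ) :
    ∃ ε ∈ K, 0 < ε ∧ (n + 1) * ε ≤ d := by
  induction n with
  | zero => exact ⟨d, hd, hd0, by simp⟩
  | succ n ih =>
    obtain ⟨ε, hε, hε0, h⟩ := ih
    obtain ⟨c, hc, hc0, hcε⟩ := hK 0 (zero_mem K) ε hε hε0
    obtain ⟨δ, hδ, hδ0, hδε⟩ : ∃ δ ∈ K, 0 < δ ∧ 2 * δ ≤ ε := by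
      rcases le_total (2 * c) ε with h2 | h2
      · exact ⟨c, hc, hc0, h2⟩
      · exact ⟨ε - c, sub_mem hε hc, by linarith, by linarith⟩
    refine ⟨δ, hδ, hδ0, le_trans ?_ h⟩
    have hn : (0 : ℝ) ≤ n := n.cast_nonneg
    push_cast
    nlinarith

namespace Chain

/-- Cutting a chain whose intermediate points lie in the window `(p, q)` at a point `g`: either the
two parts are shorter, or all the intermediate points are on the same side of `g`. -/
theorem holds_window {f : ℝ → Set ℕ} {c : Chain K} {p q x g y : ℝ} (hx : x < g) (hy : g < y)
    (h : c.holds (fun t => p < t ∧ t < q) f x y) :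
    (∃ s ∈ c.split, (s.1.length < c.length ∧ s.2.length < c.length) ∧
      s.1.sat f x g ∧ s.2.sat f g y) ∨
    c.holds (fun t => p < t ∧ t < g) f x y ∨ c.holds (fun t => g < t ∧ t < q) f x y := by
  induction c generalizing x with
  | last a b a' => exact .inr (.inl h)
  | cons a b c ih =>
    obtain ⟨h1, z, h2, h3, h4, h5, h6⟩ := h
    rcases lt_trichotomy z g with hz | rfl | hz
    · rcases ih hz h6 with ⟨s, hs, ⟨h7, h8⟩, h9, h10⟩ | h7 | h7
      · refine .inl ⟨(cons a b s.1, s.2), ?_, ⟨by simpa [length], by simp [length]; omega⟩,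
          ⟨h1, z, h2, hz, trivial, h5, h9⟩, h10⟩
        simp only [split, List.mem_cons, List.mem_map]
        exact .inr (.inr ⟨s, hs, rfl⟩)
      · exact .inr (.inl ⟨h1, z, h2, h3, ⟨h4.1, hz⟩, h5, h7⟩)
      · cases c with
        | last a₁ b₁ a₂ => exact .inr (.inl ⟨h1, z, h2, h3, ⟨h4.1, hz⟩, h5, h7⟩)
        | cons a₁ b₁ c =>
          obtain ⟨h8, w, -, h9, h10, h11, h12⟩ := h7
          refine .inl ⟨(cons a b (last a₁ b₁ b₁), cons .top b₁ c), by simp [split],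
            ⟨by simp [length], by simp [length]⟩,
            ⟨h1, z, h2, hz, trivial, h5, h8, fun u hu hu' => h11 u hu (hu'.trans h10.1),
              h11 g hz h10.1⟩,
            trivial, w, h10.1, h9, trivial, fun u hu hu' => h11 u (hz.trans hu) hu', h12.sat⟩
    · exact .inl ⟨(last a b .top, c), by simp [split], ⟨by simp [length], by simp [length]⟩,
        ⟨h1, h5, trivial⟩, h6.sat⟩
    · exact .inr (.inr ⟨h1, z, h2, h3, ⟨hz, h4.2⟩, h5,
        holds_mono (fun w hw _ h => ⟨hz.trans hw, h.2⟩) h6⟩)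

/-- The condition on the last segment. -/
def lastSeg : Chain K → UPred K
  | last _ b _ => b
  | cons _ _ c => c.lastSeg

/-- The condition at the right endpoint. -/
def lastPoint : Chain K → UPred K
  | last _ _ a' => a'
  | cons _ _ c => c.lastPoint

/-- The chain starts at `z`, with steps shorter than `ε`, and its last segment persists for at
least `ε`. -/
def Tight (ε : ℝ) (f : ℝ → Set ℕ) : Chain K → ℝ → Prop
  | last a b _, z => a.holds f z ∧ ∀ u, z < u → u < z + ε → b.holds f u
  | cons a b c, z => a.holds f z ∧
      ∃ t, z < t ∧ t < z + ε ∧ Tight ε f c t ∧ ∀ u, z < u → u < t → b.holds f u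

theorem definable_tight {ε : ℝ} (hε : ε ∈ K) (c : Chain K) :
    Definable K fun f => Tight ε f c := by
  induction c with
  | last a b a' =>
    refine (a.definable.and (b.definable.always_Ioo (zero_mem K) hε le_rfl)).congr fun f r => ?_
    simp [Tight]
  | cons a b c ih =>
    refine (a.definable.and (b.definable.untl_Ioo ih (zero_mem K) hε le_rfl)).congr
      fun f r => ?_
    simp [Tight]

theorem Tight.of_holds {ε p q z y : ℝ} {f : ℝ → Set ℕ} {c : Chain K} (hpq : q ≤ p + ε)
    (hqy : q + ε ≤ y) (hp : p < z) (hq : z < q)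
    (h : c.holds (fun t => p < t ∧ t < q) f z y) : Tight ε f c z := by
  induction c generalizing z with
  | last a b a' => exact ⟨h.1, fun u hu hu' => h.2.1 u hu (by linarith)⟩
  | cons a b c ih =>
    obtain ⟨h1, t, h2, h3, h4, h5, h6⟩ := h
    exact ⟨h1, t, h2, by linarith, ih h4.1 h4.2 h6, h5⟩

theorem lastSeg_of_holds {p q z y : ℝ} {f : ℝ → Set ℕ} {c : Chain K} (hq : z < q)
    (h : c.holds (fun t => p < t ∧ t < q) f z y) :
    ∀ u, q ≤ u → u < y → c.lastSeg.holds f u := by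
  induction c generalizing z with
  | last a b a' => exact fun u hu hu' => h.2.1 u (hq.trans_le hu) hu'
  | cons a b c ih =>
    obtain ⟨h1, t, h2, h3, h4, h5, h6⟩ := h
    exact ih h4.2 h6

theorem lastPoint_of_holds {W : ℝ → Prop} {z y : ℝ} {f : ℝ → Set ℕ} {c : Chain K}
    (h : c.holds W f z y) : c.lastPoint.holds f y := by
  induction c generalizing z with
  | last a b a' => exact h.2.2
  | cons a b c ih =>
    obtain ⟨h1, t, h2, h3, h4, h5, h6⟩ := h
    exact ih h6

theorem Tight.sat {ε p q z y : ℝ} (hε : 0 < ε) {f : ℝ → Set ℕ} {c : Chain K}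
    (hpq : q ≤ p + ε) (hp : p < z) (hy : z + c.length * ε < y) (h : Tight ε f c z)
    (hl : ∀ u, q ≤ u → u < y → c.lastSeg.holds f u) (hy' : c.lastPoint.holds f y) :
    c.sat f z y := by
  induction c generalizing z with
  | last a b a' =>
    refine ⟨h.1, fun u hu hu' => ?_, hy'⟩
    rcases lt_or_ge u (z + ε) with h' | h'
    · exact h.2 u hu h'
    · exact hl u (by linarith) hu'
  | cons a b c ih =>
    obtain ⟨h1, t, h2, h3, h4, h5⟩ := h
    simp only [length] at hy
    push_cast at hy
    have : 0 ≤ c.length * ε := by positivity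
    exact ⟨h1, t, h2, by linarith, trivial, h5, ih (by linarith) (by linarith) h4 hl hy'⟩

/-- Chains of length `d` whose intermediate points lie in a small window far from the right
endpoint. -/
theorem exists_definable_window {c : Chain K} (hc : c.length ≠ 0) {ε p q d : ℝ} (hε : ε ∈ K)
    (hp : p ∈ K) (hq : q ∈ K) (hd : d ∈ K) (hε0 : 0 < ε) (hp0 : 0 ≤ p) (hpq : p < q)
    (hqp : q ≤ p + ε) (hqd : q + c.length * ε ≤ d) :
    ∃ Q, Definable K Q ∧ ∀ f x,
      (c.holds (fun t => x + p < t ∧ t < x + q) f x (x + d) → Q f x) ∧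
        (Q f x → c.sat f x (x + d)) := by
  cases c with
  | last a b a' => exact absurd rfl hc
  | cons a b c =>
    simp only [length] at hqd
    push_cast at hqd
    have : 0 ≤ c.length * ε := by positivity
    refine ⟨_, a.definable.and ((b.definable.untl_Ioo (definable_tight hε c) hp hq hp0).and
      ((c.lastSeg.definable.shift hq).and ((c.lastSeg.definable.always_Ioo hq hd (by linarith)).and
        (c.lastPoint.definable.shift hd)))), fun f x => ⟨?_, ?_⟩⟩
    · rintro ⟨h1, z, h2, h3, h4, h5, h6⟩
      have hs := lastSeg_of_holds h4.2 h6
      exact ⟨h1, ⟨z, h4.1, h4.2, .of_holds (by linarith) (by linarith) h4.1 h4.2 h6, h5⟩,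
        hs _ le_rfl (by linarith), fun u hu hu' => hs u hu.le hu', lastPoint_of_holds h6⟩
    · rintro ⟨h1, ⟨z, h2, h3, h4, h5⟩, h6, h7, h8⟩
      refine ⟨h1, z, by linarith, by linarith, trivial, h5,
        h4.sat (p := x + p) (q := x + q) hε0 (by linarith) h2 (by linarith) (fun u hu hu' => ?_) h8⟩
      rcases hu.eq_or_lt with rfl | hu
      exacts [h6, h7 u hu hu']

/-- Chains of length `d` whose intermediate points lie in a small window far from the left
endpoint. -/
theorem exists_definable_window_rev {c : Chain K} (hc : c.length ≠ 0) {ε p q d : ℝ} (hε : ε ∈ K)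
    (hp : p ∈ K) (hq : q ∈ K) (hd : d ∈ K) (hε0 : 0 < ε) (hqd : q ≤ d) (hpq : p < q)
    (hqp : q ≤ p + ε) (hp0 : c.length * ε ≤ p) :
    ∃ Q, Definable K Q ∧ ∀ f x,
      (c.holds (fun t => x + p < t ∧ t < x + q) f x (x + d) → Q f x) ∧
        (Q f x → c.sat f x (x + d)) := by
  obtain ⟨Q, hQ, h⟩ := exists_definable_window (c := c.rev) (by rwa [length_rev]) hε
    (sub_mem hd hq) (sub_mem hd hp) hd hε0 (by linarith) (by linarith) (by linarith)
    (by rw [length_rev]; linarith)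
  refine ⟨_, hQ.rev.shift hd, fun f x => ?_⟩
  have := h (fun t => f (-t)) (-(x + d))
  simp only [sat, holds_rev, neg_neg, show -(-(x + d) + d) = x by ring] at this
  refine ⟨fun h' => this.1 (holds_mono (fun z _ _ hz => ?_) h'), this.2⟩
  constructor <;> linarith [hz.1, hz.2]

theorem definable_sat_add (hK : DenseK K) (c : Chain K) {d : ℝ} (hd : d ∈ K) (hd0 : 0 < d) :
    Definable K fun f x => c.sat f x (x + d) := by
  induction hn : c.length using Nat.strong_induction_on generalizing c d with
  | _ n ih =>
  by_cases hc : c.length = 0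
  · cases c with
    | cons a b c => simp [length] at hc
    | last a b a' =>
      refine (a.definable.and ((b.definable.always_Ioo (zero_mem K) hd le_rfl).and
        (a'.definable.shift hd))).congr fun f x => ?_
      simp [holds]
  subst hn
  obtain ⟨ε, hε, hε0, hεd⟩ := hK.exists_small hd hd0 (2 * c.length)
  push_cast at hεd
  have hmul : ∀ j : ℕ, j * ε ∈ K := fun j => by
    simpa using nsmul_mem hε j
  have hex : ∃ m : ℕ, d ≤ (m + 1) * ε := by
    obtain ⟨m, hm⟩ := exists_nat_ge (d / ε)
    refine ⟨m, ?_⟩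
    rw [div_le_iff₀ hε0] at hm
    linarith
  obtain ⟨m, hm, hmin⟩ : ∃ m : ℕ, d ≤ (m + 1) * ε ∧ m * ε < d := by
    classical
    refine ⟨Nat.find hex, Nat.find_spec hex, ?_⟩
    rcases h : Nat.find hex with _ | k
    · simpa
    · have := Nat.find_min hex (m := k) (by omega)
      push_cast
      exact not_le.1 this
  have hjm : ∀ j : ℕ, j ≤ m → j * ε < d := fun j hj =>
    (mul_le_mul_of_nonneg_right (Nat.cast_le.2 hj) hε0.le).trans_lt hmin
  have hwin : ∀ j : ℕ, ∃ Q, j ≤ m → Definable K Q ∧ ∀ f x,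
      (c.holds (fun t => x + j * ε < t ∧ t < x + min ((j + 1 : ℕ) * ε) d) f x (x + d) → Q f x) ∧
        (Q f x → c.sat f x (x + d)) := by
    intro j
    by_cases hj : j ≤ m
    swap
    · exact ⟨fun _ _ => False, fun h => absurd h hj⟩
    have hqK : min ((j + 1 : ℕ) * ε) d ∈ K := by
      rcases min_choice ((j + 1 : ℕ) * ε) d with h | h <;> rw [h]
      exacts [hmul _, hd]
    have h1 : (j + 1 : ℕ) * ε = j * ε + ε := by push_cast; ring
    have h2 := hjm j hj
    have h3 : j * ε < min ((j + 1 : ℕ) * ε) d := lt_min (by linarith) h2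
    have h4 : min ((j + 1 : ℕ) * ε) d ≤ j * ε + ε := (min_le_left _ _).trans h1.le
    rcases le_total (c.length * ε) (j * ε) with h | h
    · obtain ⟨Q, hQ⟩ := exists_definable_window_rev hc hε (hmul j) hqK hd hε0 (min_le_right _ _)
        h3 h4 h
      exact ⟨Q, fun _ => hQ⟩
    · obtain ⟨Q, hQ⟩ := exists_definable_window hc hε (hmul j) hqK hd hε0 (by positivity)
        h3 h4 (by linarith)
      exact ⟨Q, fun _ => hQ⟩
  choose Q hQ using hwin
  refine ((Definable.exists_mem (List.range m) (Q := fun j f x => ∃ s ∈ c.split,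
      (s.1.length < c.length ∧ s.2.length < c.length) ∧ s.1.sat f x (x + (j + 1 : ℕ) * ε) ∧
        s.2.sat f (x + (j + 1 : ℕ) * ε) (x + d)) fun j hj => ?_).or
    (Definable.exists_mem (List.range (m + 1)) (Q := Q) fun j hj => ?_)).congr fun f x => ?_
  · rw [List.mem_range] at hj
    refine Definable.exists_mem _ fun s hs => ?_
    by_cases h : s.1.length < c.length ∧ s.2.length < c.length
    · have h1 := ih _ h.1 s.1 (hmul (j + 1)) (by positivity) rfl
      have h2 := (ih _ h.2 s.2 (sub_mem hd (hmul (j + 1)))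
        (sub_pos.2 (hjm (j + 1) hj)) rfl).shift (hmul (j + 1))
      refine (h1.and h2).congr fun f x => ?_
      rw [add_add_sub_cancel]
      simp [h]
    · exact (Definable.const False).congr fun f x => by simp [h]
  · exact (hQ j (by simpa [Nat.lt_succ_iff] using hj)).1
  · constructor
    · intro h
      have key : ∀ i ≤ m, (∃ j < i, ∃ s ∈ c.split,
          (s.1.length < c.length ∧ s.2.length < c.length) ∧ s.1.sat f x (x + (j + 1 : ℕ) * ε) ∧
            s.2.sat f (x + (j + 1 : ℕ) * ε) (x + d)) ∨
          (∃ j < i, c.holds (fun t => x + j * ε < t ∧ t < x + (j + 1 : ℕ) * ε) f x (x + d)) ∨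
          c.holds (fun t => x + i * ε < t ∧ t < x + d) f x (x + d) := by
        intro i hi
        induction i with
        | zero =>
          exact .inr (.inr (holds_mono (fun z h1 h2 _ => ⟨by simpa using h1, h2⟩) h))
        | succ i ih =>
          rcases ih (by omega) with ⟨j, hj, h⟩ | ⟨j, hj, h⟩ | h
          · exact .inl ⟨j, by omega, h⟩
          · exact .inr (.inl ⟨j, by omega, h⟩)
          · have h1 : x < x + (i + 1 : ℕ) * ε := by
              have : 0 < (i + 1 : ℕ) * ε := by positivity
              linarith
            have h2 : x + (i + 1 : ℕ) * ε < x + d := by linarith [hjm (i + 1) hi]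
            rcases holds_window h1 h2 h with h | h | h
            · exact .inl ⟨i, by omega, h⟩
            · exact .inr (.inl ⟨i, by omega, h⟩)
            · exact .inr (.inr h)
      simp only [List.mem_range]
      rcases key m le_rfl with h | ⟨j, hj, h⟩ | h
      · exact .inl h
      · refine .inr ⟨j, by omega, ((hQ j hj.le).2 f x).1 ?_⟩
        rwa [min_eq_left (hjm (j + 1) hj).le]
      · refine .inr ⟨m, by omega, ((hQ m le_rfl).2 f x).1 ?_⟩
        rwa [min_eq_right (by push_cast; exact hm)]
    · rintro (⟨j, hj, s, hs, -, h1, h2⟩ | ⟨j, hj, h⟩)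
      · rw [List.mem_range] at hj
        have h3 : 0 < (j + 1 : ℕ) * ε := by positivity
        exact sat_of_mem_split hs (by linarith) (by linarith [hjm (j + 1) hj]) h1 h2
      · exact ((hQ j (by simpa [Nat.lt_succ_iff] using hj)).2 f x).2 h

end Chain

theorem Decomp.definable_add {R : (ℝ → Set ℕ) → ℝ → ℝ → Prop} (hR : Decomp K R) (hK : DenseK K)
    {d : ℝ} (hd : d ∈ K) (hd0 : 0 < d) : Definable K fun f x => R f x (x + d) := by
  obtain ⟨L, hL⟩ := hR
  exact (Definable.exists_mem L fun c _ => c.definable_sat_add hK hd hd0).congr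
    fun f x => hL f x _ (by linarith)

/-! ### Quantifier elimination -/

/-- Relations between a signal and the values of the variables in `S`, generated by unary
predicates, equalities between terms and decomposable relations between terms. -/
inductive Rel (K : AddSubgroup ℝ) (S : Set ℕ) : ((ℝ → Set ℕ) → (ℕ → ℝ) → Prop) → Prop
  | const (p : Prop) : Rel K S fun _ _ => p
  | un (a : UPred K) {i : ℕ} (hi : i ∈ S) : Rel K S fun f v => a.holds f (v i)
  | eq {i j : ℕ} (hi : i ∈ S) (hj : j ∈ S) (c : K) : Rel K S fun _ v => v i + c = v j
  | bd {i j : ℕ} (hi : i ∈ S) (hj : j ∈ S) (c : K) {R : (ℝ → Set ℕ) → ℝ → ℝ → Prop}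
      (hR : Decomp K R) : Rel K S fun f v => v i + c < v j ∧ R f (v i + c) (v j)
  | and {A B : (ℝ → Set ℕ) → (ℕ → ℝ) → Prop} (hA : Rel K S A) (hB : Rel K S B) :
      Rel K S fun f v => A f v ∧ B f v
  | or {A B : (ℝ → Set ℕ) → (ℕ → ℝ) → Prop} (hA : Rel K S A) (hB : Rel K S B) :
      Rel K S fun f v => A f v ∨ B f v
  | congr {A B : (ℝ → Set ℕ) → (ℕ → ℝ) → Prop} (hA : Rel K S A)
      (h : ∀ f v, B f v ↔ A f v) : Rel K S B

namespace Rel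

variable {S T : Set ℕ} {A : (ℝ → Set ℕ) → (ℕ → ℝ) → Prop}

theorem mono (h : S ⊆ T) (hA : Rel K S A) : Rel K T A := by
  induction hA with
  | const p => exact const p
  | un a hi => exact un a (h hi)
  | eq hi hj c => exact eq (h hi) (h hj) c
  | bd hi hj c hR => exact bd (h hi) (h hj) c hR
  | and _ _ ihA ihB => exact ihA.and ihB
  | or _ _ ihA ihB => exact ihA.or ihB
  | congr _ h ih => exact ih.congr h

theorem un_add (a : UPred K) {i : ℕ} (hi : i ∈ S) (c : K) :
    Rel K S fun f v => a.holds f (v i + c) :=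
  un (a.shift c) hi

theorem eq_add {i j : ℕ} (hi : i ∈ S) (hj : j ∈ S) (c d : K) :
    Rel K S fun _ v => v i + c = v j + d :=
  (eq hi hj (c - d)).congr fun f v => by
    rw [AddSubgroup.coe_sub, ← add_sub_assoc, sub_eq_iff_eq_add]

theorem bd_add {i j : ℕ} (hi : i ∈ S) (hj : j ∈ S) (c d : K)
    {R : (ℝ → Set ℕ) → ℝ → ℝ → Prop} (hR : Decomp K R) :
    Rel K S fun f v => v i + c < v j + d ∧ R f (v i + c) (v j + d) :=
  (bd hi hj (c - d) (hR.shift d)).congr fun f v => by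
    rw [AddSubgroup.coe_sub, ← add_sub_assoc, sub_lt_iff_lt_add, sub_add_cancel]

theorem lt_add {i j : ℕ} (hi : i ∈ S) (hj : j ∈ S) (c d : K) :
    Rel K S fun _ v => v i + c < v j + d :=
  (bd_add hi hj c d .true).congr fun _ _ => (and_iff_left trivial).symm

theorem not (hA : Rel K S A) : Rel K S fun f v => ¬ A f v := by
  induction hA with
  | const p => exact const _
  | un a hi => exact un a.not hi
  | eq hi hj c =>
    refine ((lt_add hi hj c 0).or (lt_add hj hi 0 c)).congr fun f v => ?_
    simp
  | bd hi hj c hR =>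
    refine (((lt_add hj hi 0 c).or (eq hi hj c)).or (bd hi hj c hR.not)).congr fun f v => ?_
    rw [not_and_or, not_lt, le_iff_lt_or_eq]
    simp only [ZeroMemClass.coe_zero, add_zero]
    grind
  | and _ _ ihA ihB => exact (ihA.or ihB).congr fun f v => not_and_or
  | or _ _ ihA ihB => exact (ihA.and ihB).congr fun f v => not_or
  | congr _ h ih => exact ih.congr fun f v => not_congr (h f v)

end Rel

/-- Conditions on a point `r` that bound it from below by terms not containing `y`. -/
inductive Lower (K : AddSubgroup ℝ) (y : ℕ) : ((ℝ → Set ℕ) → (ℕ → ℝ) → ℝ → Prop) → Prop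
  | env {e : (ℝ → Set ℕ) → (ℕ → ℝ) → Prop} (he : Rel K {y}ᶜ e) : Lower K y fun f v _ => e f v
  | bd {e : (ℝ → Set ℕ) → (ℕ → ℝ) → Prop} (he : Rel K {y}ᶜ e) {j : ℕ}
      (hj : j ∈ ({y}ᶜ : Set ℕ)) (c : K) {R : (ℝ → Set ℕ) → ℝ → ℝ → Prop} (hR : Decomp K R) :
      Lower K y fun f v r => e f v ∧ v j + c < r ∧ R f (v j + c) r
  | or {A B : (ℝ → Set ℕ) → (ℕ → ℝ) → ℝ → Prop} (hA : Lower K y A) (hB : Lower K y B) :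
      Lower K y fun f v r => A f v r ∨ B f v r
  | congr {A B : (ℝ → Set ℕ) → (ℕ → ℝ) → ℝ → Prop} (hA : Lower K y A)
      (h : ∀ f v r, B f v r ↔ A f v r) : Lower K y B

/-- Conditions on a point `r` that bound it from above by terms not containing `y`. -/
inductive Upper (K : AddSubgroup ℝ) (y : ℕ) : ((ℝ → Set ℕ) → (ℕ → ℝ) → ℝ → Prop) → Prop
  | env {e : (ℝ → Set ℕ) → (ℕ → ℝ) → Prop} (he : Rel K {y}ᶜ e) : Upper K y fun f v _ => e f v
  | bd {e : (ℝ → Set ℕ) → (ℕ → ℝ) → Prop} (he : Rel K {y}ᶜ e) {j : ℕ}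
      (hj : j ∈ ({y}ᶜ : Set ℕ)) (c : K) {R : (ℝ → Set ℕ) → ℝ → ℝ → Prop} (hR : Decomp K R) :
      Upper K y fun f v r => e f v ∧ r < v j + c ∧ R f r (v j + c)
  | or {A B : (ℝ → Set ℕ) → (ℕ → ℝ) → ℝ → Prop} (hA : Upper K y A) (hB : Upper K y B) :
      Upper K y fun f v r => A f v r ∨ B f v r
  | congr {A B : (ℝ → Set ℕ) → (ℕ → ℝ) → ℝ → Prop} (hA : Upper K y A)
      (h : ∀ f v r, B f v r ↔ A f v r) : Upper K y B

namespace Lower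

variable {y : ℕ} {A B : (ℝ → Set ℕ) → (ℕ → ℝ) → ℝ → Prop}

theorem exists_mem {ι : Type*} {A : ι → (ℝ → Set ℕ) → (ℕ → ℝ) → ℝ → Prop} (L : List ι)
    (h : ∀ i ∈ L, Lower K y (A i)) : Lower K y fun f v r => ∃ i ∈ L, A i f v r := by
  induction L with
  | nil => exact (env (.const False)).congr fun f v r => by simp
  | cons i L ih =>
    exact ((h i (by simp)).or (ih fun j hj => h j (by simp [hj]))).congr fun f v r => by simp

theorem env_and {e : (ℝ → Set ℕ) → (ℕ → ℝ) → Prop} (he : Rel K {y}ᶜ e) (hA : Lower K y A) :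
    Lower K y fun f v r => e f v ∧ A f v r := by
  induction hA with
  | env h => exact env (he.and h)
  | bd h hj c hR => exact (bd (he.and h) hj c hR).congr fun f v r => and_assoc.symm
  | or _ _ ihA ihB => exact (ihA.or ihB).congr fun f v r => and_or_left
  | congr _ h ih => exact ih.congr fun f v r => and_congr_right fun _ => h f v r

/-- Conjunction of two lower bounds, the second of which is the tighter one. -/
theorem bd_and_bd {i j : ℕ} (hi : i ∈ ({y}ᶜ : Set ℕ)) (hj : j ∈ ({y}ᶜ : Set ℕ)) (c d : K)
    {R S : (ℝ → Set ℕ) → ℝ → ℝ → Prop} (hR : Decomp K R) (hS : Decomp K S) :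
    Lower K y fun f v r => v i + c < v j + d ∧ (v i + c < r ∧ R f (v i + c) r) ∧
      v j + d < r ∧ S f (v j + d) r := by
  obtain ⟨L, hL⟩ := hR.cut
  refine (exists_mem L fun p _ =>
    bd (Rel.bd_add hi hj c d (.of_chain p.1)) hj d (hS.and (.of_chain p.2))).congr
    fun f v r => ⟨?_, ?_⟩
  · rintro ⟨h1, ⟨-, h2⟩, h3, h4⟩
    obtain ⟨p, hp, h5, h6⟩ := (hL f _ _ _ h1 h3).1 h2
    exact ⟨p, hp, ⟨h1, h5⟩, h3, h4, h6⟩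
  · rintro ⟨p, hp, ⟨h1, h5⟩, h3, h4, h6⟩
    exact ⟨h1, ⟨h1.trans h3, (hL f _ _ _ h1 h3).2 ⟨p, hp, h5, h6⟩⟩, h3, h4⟩

theorem and (hA : Lower K y A) (hB : Lower K y B) : Lower K y fun f v r => A f v r ∧ B f v r := by
  induction hA with
  | env h => exact env_and h hB
  | @bd e he i hi c R hR =>
    induction hB with
    | env h => exact (env_and h (bd he hi c hR)).congr fun f v r => and_comm
    | @bd e' he' j hj d S hS =>
      refine (env_and (he.and he') (((bd_and_bd hi hj c d hR hS).or
        (bd_and_bd hj hi d c hS hR)).or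
        (bd (Rel.eq_add hi hj c d) hi c (hR.and hS)))).congr fun f v r => ?_
      rcases lt_trichotomy (v i + c) (v j + d) with h | h | h
      · simp only [h, h.ne, h.asymm, true_and, false_and, or_false]
        tauto
      · simp only [h, lt_irrefl, true_and, false_and, or_false, false_or]
        tauto
      · simp only [h, h.ne', h.asymm, true_and, false_and, or_false, false_or]
        tauto
    | or _ _ ihA ihB => exact (ihA.or ihB).congr fun f v r => and_or_left
    | congr _ h ih => exact ih.congr fun f v r => and_congr_right fun _ => h f v r
  | or _ _ ihA ihB => exact (ihA.or ihB).congr fun f v r => or_and_right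
  | congr _ h ih => exact ih.congr fun f v r => and_congr_left fun _ => h f v r

theorem subst (hA : Lower K y A) {j : ℕ} (hj : j ∈ ({y}ᶜ : Set ℕ)) (c : K) :
    Rel K {y}ᶜ fun f v => A f v (v j + c) := by
  induction hA with
  | env h => exact h
  | bd he hi d hR => exact he.and (.bd_add hi hj d c hR)
  | or _ _ ihA ihB => exact ihA.or ihB
  | congr _ h ih => exact ih.congr fun f v => h f v _

end Lower

namespace Upper

variable {y : ℕ} {A B : (ℝ → Set ℕ) → (ℕ → ℝ) → ℝ → Prop}

theorem exists_mem {ι : Type*} {A : ι → (ℝ → Set ℕ) → (ℕ → ℝ) → ℝ → Prop} (L : List ι)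
    (h : ∀ i ∈ L, Upper K y (A i)) : Upper K y fun f v r => ∃ i ∈ L, A i f v r := by
  induction L with
  | nil => exact (env (.const False)).congr fun f v r => by simp
  | cons i L ih =>
    exact ((h i (by simp)).or (ih fun j hj => h j (by simp [hj]))).congr fun f v r => by simp

theorem env_and {e : (ℝ → Set ℕ) → (ℕ → ℝ) → Prop} (he : Rel K {y}ᶜ e) (hA : Upper K y A) :
    Upper K y fun f v r => e f v ∧ A f v r := by
  induction hA with
  | env h => exact env (he.and h)
  | bd h hj c hR => exact (bd (he.and h) hj c hR).congr fun f v r => and_assoc.symm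
  | or _ _ ihA ihB => exact (ihA.or ihB).congr fun f v r => and_or_left
  | congr _ h ih => exact ih.congr fun f v r => and_congr_right fun _ => h f v r

/-- Conjunction of two upper bounds, the second of which is the tighter one. -/
theorem bd_and_bd {i j : ℕ} (hi : i ∈ ({y}ᶜ : Set ℕ)) (hj : j ∈ ({y}ᶜ : Set ℕ)) (c d : K)
    {R S : (ℝ → Set ℕ) → ℝ → ℝ → Prop} (hR : Decomp K R) (hS : Decomp K S) :
    Upper K y fun f v r => v j + d < v i + c ∧ (r < v i + c ∧ R f r (v i + c)) ∧
      r < v j + d ∧ S f r (v j + d) := by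
  obtain ⟨L, hL⟩ := hR.cut
  refine (exists_mem L fun p _ =>
    bd (Rel.bd_add hj hi d c (.of_chain p.2)) hj d (hS.and (.of_chain p.1))).congr
    fun f v r => ⟨?_, ?_⟩
  · rintro ⟨h1, ⟨-, h2⟩, h3, h4⟩
    obtain ⟨p, hp, h5, h6⟩ := (hL f _ _ _ h3 h1).1 h2
    exact ⟨p, hp, ⟨h1, h6⟩, h3, h4, h5⟩
  · rintro ⟨p, hp, ⟨h1, h6⟩, h3, h4, h5⟩
    exact ⟨h1, ⟨h3.trans h1, (hL f _ _ _ h3 h1).2 ⟨p, hp, h5, h6⟩⟩, h3, h4⟩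

theorem and (hA : Upper K y A) (hB : Upper K y B) : Upper K y fun f v r => A f v r ∧ B f v r := by
  induction hA with
  | env h => exact env_and h hB
  | @bd e he i hi c R hR =>
    induction hB with
    | env h => exact (env_and h (bd he hi c hR)).congr fun f v r => and_comm
    | @bd e' he' j hj d S hS =>
      refine (env_and (he.and he') (((bd_and_bd hi hj c d hR hS).or
        (bd_and_bd hj hi d c hS hR)).or
        (bd (Rel.eq_add hi hj c d) hi c (hR.and hS)))).congr fun f v r => ?_
      rcases lt_trichotomy (v i + c) (v j + d) with h | h | h
      · simp only [h, h.ne, h.asymm, true_and, false_and, or_false, false_or]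
        tauto
      · simp only [h, lt_irrefl, true_and, false_and, or_false, false_or]
        tauto
      · simp only [h, h.ne', h.asymm, true_and, false_and, or_false]
        tauto
    | or _ _ ihA ihB => exact (ihA.or ihB).congr fun f v r => and_or_left
    | congr _ h ih => exact ih.congr fun f v r => and_congr_right fun _ => h f v r
  | or _ _ ihA ihB => exact (ihA.or ihB).congr fun f v r => or_and_right
  | congr _ h ih => exact ih.congr fun f v r => and_congr_left fun _ => h f v r

theorem subst (hA : Upper K y A) {j : ℕ} (hj : j ∈ ({y}ᶜ : Set ℕ)) (c : K) :
    Rel K {y}ᶜ fun f v => A f v (v j + c) := by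
  induction hA with
  | env h => exact h
  | bd he hi d hR => exact he.and (.bd_add hj hi c d hR)
  | or _ _ ihA ihB => exact ihA.or ihB
  | congr _ h ih => exact ih.congr fun f v => h f v _

end Upper

/-- Conditions on a point `r`, in terms of variables other than `y`, from which an existential
quantifier over `r` can be eliminated. -/
inductive Elim (K : AddSubgroup ℝ) (y : ℕ) : ((ℝ → Set ℕ) → (ℕ → ℝ) → ℝ → Prop) → Prop
  | mk {A B : (ℝ → Set ℕ) → (ℕ → ℝ) → ℝ → Prop} (hA : Lower K y A) (hB : Upper K y B)
      (a : UPred K) : Elim K y fun f v r => (A f v r ∧ B f v r) ∧ a.holds f r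
  | eq {e : (ℝ → Set ℕ) → (ℕ → ℝ) → Prop} (he : Rel K {y}ᶜ e) {j : ℕ}
      (hj : j ∈ ({y}ᶜ : Set ℕ)) (c : K) : Elim K y fun f v r => e f v ∧ v j + c = r
  | or {A B : (ℝ → Set ℕ) → (ℕ → ℝ) → ℝ → Prop} (hA : Elim K y A) (hB : Elim K y B) :
      Elim K y fun f v r => A f v r ∨ B f v r
  | congr {A B : (ℝ → Set ℕ) → (ℕ → ℝ) → ℝ → Prop} (hA : Elim K y A)
      (h : ∀ f v r, B f v r ↔ A f v r) : Elim K y B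

namespace Elim

variable {y : ℕ} {A B : (ℝ → Set ℕ) → (ℕ → ℝ) → ℝ → Prop}

theorem subst (hA : Elim K y A) {j : ℕ} (hj : j ∈ ({y}ᶜ : Set ℕ)) (c : K) :
    Rel K {y}ᶜ fun f v => A f v (v j + c) := by
  induction hA with
  | mk hA hB a => exact ((hA.subst hj c).and (hB.subst hj c)).and (.un_add a hj c)
  | eq he hi d => exact he.and (.eq_add hi hj d c)
  | or _ _ ihA ihB => exact ihA.or ihB
  | congr _ h ih => exact ih.congr fun f v => h f v _

theorem eq_and {e : (ℝ → Set ℕ) → (ℕ → ℝ) → Prop} (he : Rel K {y}ᶜ e) {j : ℕ}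
    (hj : j ∈ ({y}ᶜ : Set ℕ)) (c : K) (hA : Elim K y A) :
    Elim K y fun f v r => (e f v ∧ v j + c = r) ∧ A f v r :=
  (eq (he.and (hA.subst hj c)) hj c).congr fun f v r => by
    constructor
    · rintro ⟨⟨h, rfl⟩, h'⟩
      exact ⟨⟨h, h'⟩, rfl⟩
    · rintro ⟨⟨h, h'⟩, rfl⟩
      exact ⟨⟨h, rfl⟩, h'⟩

theorem and (hA : Elim K y A) (hB : Elim K y B) : Elim K y fun f v r => A f v r ∧ B f v r := by
  induction hA with
  | eq he hj c => exact eq_and he hj c hB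
  | mk hA hA' a =>
    induction hB with
    | eq he hj c => exact (eq_and he hj c (mk hA hA' a)).congr fun f v r => and_comm
    | mk hB hB' b =>
      refine (mk (hA.and hB) (hA'.and hB') (a.and b)).congr fun f v r => ?_
      simp only [UPred.and]
      tauto
    | or _ _ ihA ihB => exact (ihA.or ihB).congr fun f v r => and_or_left
    | congr _ h ih => exact ih.congr fun f v r => and_congr_right fun _ => h f v r
  | or _ _ ihA ihB => exact (ihA.or ihB).congr fun f v r => or_and_right
  | congr _ h ih => exact ih.congr fun f v r => and_congr_left fun _ => h f v r

theorem of_lower (hA : Lower K y A) : Elim K y A :=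
  (mk hA (.env (.const True)) .top).congr fun f v r => by simp [UPred.top]

theorem of_upper (hA : Upper K y A) : Elim K y A :=
  (mk (.env (.const True)) hA .top).congr fun f v r => by simp [UPred.top]

theorem of_env {e : (ℝ → Set ℕ) → (ℕ → ℝ) → Prop} (he : Rel K {y}ᶜ e) :
    Elim K y fun f v _ => e f v :=
  of_lower (.env he)

theorem of_un (a : UPred K) : Elim K y fun f _ r => a.holds f r :=
  (mk (.env (.const True)) (.env (.const True)) a).congr fun f v r => by simp

theorem of_rel (hK : DenseK K) {A : (ℝ → Set ℕ) → (ℕ → ℝ) → Prop} (hA : Rel K Set.univ A)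
    (y : ℕ) : Elim K y fun f v r => A f (Function.update v y r) := by
  induction hA with
  | const p => exact of_env (.const p)
  | @un a i _ =>
    by_cases hi : i = y
    · subst hi
      simpa using of_un a
    · simpa [hi] using of_env (.un a (by simpa using hi))
  | @eq i j _ _ c =>
    by_cases hi : i = y <;> by_cases hj : j = y
    · subst hi hj
      simpa using of_env (y := j) (K := K) (.const ((c : ℝ) = 0))
    · subst hi
      refine (eq (.const True) (j := j) (by simpa using hj) (-c)).congr fun f v r => ?_
      simp only [Function.update_self, Function.update_of_ne hj, NegMemClass.coe_neg, true_and]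
      rw [← sub_eq_add_neg, sub_eq_iff_eq_add, eq_comm]
    · subst hj
      exact (eq (.const True) (j := i) (by simpa using hi) c).congr fun f v r => by simp [hi]
    · simpa [hi, hj] using of_env (.eq (by simpa using hi) (by simpa using hj) c)
  | @bd i j _ _ c R hR =>
    by_cases hi : i = y <;> by_cases hj : j = y
    · subst hi hj
      simp only [Function.update_self, add_lt_iff_neg_left]
      by_cases hc : (c : ℝ) < 0
      · refine (of_un ⟨_, (hR.definable_add hK (neg_mem c.2) (neg_pos.2 hc)).shift c.2⟩).congr
          fun f v r => ?_
        simp [hc]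
      · exact (of_env (.const False)).congr fun f v r => by simp [hc]
    · subst hi
      refine (of_upper (.bd (.const True) (j := j) (by simpa using hj) (-c)
        (hR.shift c))).congr fun f v r => ?_
      simp [hj, ← sub_eq_add_neg, lt_sub_iff_add_lt]
    · subst hj
      exact (of_lower (.bd (.const True) (j := i) (by simpa using hi) c hR)).congr
        fun f v r => by simp [hi]
    · simpa [hi, hj] using of_env (.bd (by simpa using hi) (by simpa using hj) c hR)
  | and _ _ ihA ihB => exact ihA.and ihB
  | or _ _ ihA ihB => exact ihA.or ihB
  | congr _ h ih => exact ih.congr fun f v r => h f _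

theorem exists_upper (hB : Upper K y B) (a : UPred K) :
    Rel K {y}ᶜ fun f v => ∃ r, B f v r ∧ a.holds f r := by
  induction hB with
  | env he =>
    have hy : y + 1 ∈ ({y}ᶜ : Set ℕ) := by simp
    refine (he.and ((Rel.un a hy).or ((Rel.un ⟨_, (Decomp.right a).definable_exists_after⟩ hy).or
      (.un ⟨_, (Decomp.left a).definable_exists_before⟩ hy)))).congr fun f v => ?_
    rw [exists_and_left]
    refine and_congr_right fun _ => ⟨?_, ?_⟩
    · rintro ⟨r, hr⟩
      rcases lt_trichotomy (v (y + 1)) r with h | h | h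
      exacts [.inr (.inl ⟨r, h, hr⟩), .inl (h ▸ hr), .inr (.inr ⟨r, h, hr⟩)]
    · rintro (h | ⟨r, -, h⟩ | ⟨r, -, h⟩)
      exacts [⟨_, h⟩, ⟨_, h⟩, ⟨_, h⟩]
  | bd he hj c hR =>
    refine (he.and (.un_add ⟨_, (hR.and (.left a)).definable_exists_before⟩ hj c)).congr
      fun f v => ?_
    simp only [and_assoc, exists_and_left]
  | or _ _ ihA ihB =>
    refine (ihA.or ihB).congr fun f v => ?_
    simp only [or_and_right, exists_or]
  | congr _ h ih => exact ih.congr fun f v => exists_congr fun r => by rw [h]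

theorem exists_bd {i : ℕ} (hi : i ∈ ({y}ᶜ : Set ℕ)) (c : K)
    {R : (ℝ → Set ℕ) → ℝ → ℝ → Prop} (hR : Decomp K R) (hB : Upper K y B) :
    Rel K {y}ᶜ fun f v => ∃ r, v i + c < r ∧ R f (v i + c) r ∧ B f v r := by
  induction hB with
  | env he =>
    refine (he.and (.un_add ⟨_, hR.definable_exists_after⟩ hi c)).congr fun f v => ?_
    simp only [← and_assoc, exists_and_right]
    exact and_comm
  | bd he hj d hS =>
    refine (he.and (.bd_add hi hj c d (hR.comp hS))).congr fun f v => ⟨?_, ?_⟩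
    · rintro ⟨r, h1, h2, h3, h4, h5⟩
      exact ⟨h3, h1.trans h4, r, h1, h4, h2, h5⟩
    · rintro ⟨h3, -, r, h1, h4, h2, h5⟩
      exact ⟨r, h1, h2, h3, h4, h5⟩
  | or _ _ ihA ihB =>
    refine (ihA.or ihB).congr fun f v => ?_
    simp only [and_or_left, exists_or]
  | congr _ h ih => exact ih.congr fun f v => exists_congr fun r => by rw [h]

theorem exists_lower_upper (hA : Lower K y A) (hB : Upper K y B) (a : UPred K) :
    Rel K {y}ᶜ fun f v => ∃ r, (A f v r ∧ B f v r) ∧ a.holds f r := by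
  induction hA with
  | env he =>
    refine (he.and (exists_upper hB a)).congr fun f v => ?_
    simp only [and_assoc, exists_and_left]
  | bd he hi c hR =>
    refine (he.and (exists_bd hi c (hR.and (.right a)) hB)).congr fun f v => ?_
    rw [← exists_and_left]
    exact exists_congr fun r => by tauto
  | or _ _ ihA ihB =>
    refine (ihA.or ihB).congr fun f v => ?_
    simp only [or_and_right, exists_or]
  | congr _ h ih => exact ih.congr fun f v => exists_congr fun r => by rw [h]

theorem exists_rel (hA : Elim K y A) : Rel K {y}ᶜ fun f v => ∃ r, A f v r := by
  induction hA with
  | mk hA hB a => exact exists_lower_upper hA hB a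
  | eq he hj c => exact he.congr fun f v => by simp
  | or _ _ ihA ihB => exact (ihA.or ihB).congr fun f v => exists_or
  | congr _ h ih => exact ih.congr fun f v => exists_congr fun r => h f v r

end Elim

theorem FO.rel_sat (hK : DenseK K) (φ : FO K ℕ) : Rel K Set.univ fun f v => φ.sat f v := by
  induction φ with
  | tt => exact .const True
  | atom p t => exact .un_add ⟨_, .atom p, fun f r => Iff.rfl⟩ (Set.mem_univ t.1) t.2
  | lt s t => exact .lt_add (Set.mem_univ s.1) (Set.mem_univ t.1) s.2 t.2
  | conj φ ψ ih1 ih2 => exact ih1.and ih2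
  | neg φ ih => exact ih.not
  | ex y φ ih => exact (Elim.of_rel hK ih y).exists_rel.mono (Set.subset_univ _)

theorem Rel.definable (hK : DenseK K) {S : Set ℕ} {A : (ℝ → Set ℕ) → (ℕ → ℝ) → Prop}
    (hA : Rel K S A) : Definable K fun f r => A f fun _ => r := by
  induction hA with
  | const p => exact .const p
  | un a _ => exact a.definable
  | eq _ _ c => exact (Definable.const ((c : ℝ) = 0)).congr fun f r => by simp
  | bd _ _ c hR =>
    by_cases hc : (c : ℝ) < 0
    · refine ((hR.definable_add hK (neg_mem c.2) (neg_pos.2 hc)).shift c.2).congr fun f r => ?_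
      simp [hc]
    · exact (Definable.const False).congr fun f r => by simp [hc]
  | and _ _ ihA ihB => exact ihA.and ihB
  | or _ _ ihA ihB => exact ihA.or ihB
  | congr _ h ih => exact ih.congr fun f r => h f _

theorem FO.exists_mtl (hK : DenseK K) (φ : FO K ℕ) : ∃ ψ : MTL K ℕ, EquivFOMTL φ ψ :=
  (φ.rel_sat hK).definable hK

/-! ### From `MTL_K` to `FO_K` -/

theorem MTLI.exists_fo (I : MTLI K) (s t : ℕ) :
    ∃ φ : FO K P, φ.free ⊆ {s, t} ∧ ∀ f v, φ.sat f v ↔ I.mem (v t - v s) := by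
  have hlo : ∃ φ : FO K P, φ.free ⊆ {s, t} ∧ ∀ f v, φ.sat f v ↔
      if I.loClosed then I.lo ≤ v t - v s else I.lo < v t - v s := by
    cases I.loClosed
    · refine ⟨.lt (s, ⟨I.lo, I.lo_mem⟩) (t, 0), by simp [FO.free], fun f v => ?_⟩
      simp [FO.sat, Term.val, lt_sub_iff_add_lt, add_comm]
    · refine ⟨.neg (.lt (t, 0) (s, ⟨I.lo, I.lo_mem⟩)), by simp [FO.free, Set.pair_comm],
        fun f v => ?_⟩
      simp [FO.sat, Term.val, le_sub_iff_add_le, add_comm]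
  have hhi : ∃ φ : FO K P, φ.free ⊆ {s, t} ∧ ∀ f v, φ.sat f v ↔
      ∀ h : ℝ, I.hi = some h → if I.hiClosed then v t - v s ≤ h else v t - v s < h := by
    rcases hI : I.hi with _ | h
    · exact ⟨.tt, by simp [FO.free], fun f v => by simp [FO.sat]⟩
    have hK := (I.hi_mem h hI).1
    cases I.hiClosed
    · refine ⟨.lt (t, 0) (s, ⟨h, hK⟩), by simp [FO.free, Set.pair_comm], fun f v => ?_⟩
      simp [FO.sat, Term.val, sub_lt_iff_lt_add']
    · refine ⟨.neg (.lt (s, ⟨h, hK⟩) (t, 0)), by simp [FO.free], fun f v => ?_⟩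
      simp [FO.sat, Term.val, add_comm]
  obtain ⟨φ, h1, h2⟩ := hlo
  obtain ⟨ψ, h3, h4⟩ := hhi
  exact ⟨.conj φ ψ, Set.union_subset h1 h3, fun f v => and_congr (h2 f v) (h4 f v)⟩

theorem MTL.exists_fo (ψ : MTL K P) (x : ℕ) :
    ∃ φ : FO K P, φ.free ⊆ {x} ∧ ∀ f v, φ.sat f v ↔ ψ.sat f (v x) := by
  induction ψ generalizing x with
  | tt => exact ⟨.tt, by simp [FO.free], fun f v => Iff.rfl⟩
  | atom p => exact ⟨.atom p (x, 0), by simp [FO.free], fun f v => by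
      simp [FO.sat, MTL.sat, Term.val]⟩
  | conj a b ha hb =>
    obtain ⟨φ, h1, h2⟩ := ha x
    obtain ⟨ψ, h3, h4⟩ := hb x
    exact ⟨.conj φ ψ, Set.union_subset h1 h3, fun f v => and_congr (h2 f v) (h4 f v)⟩
  | neg a ha =>
    obtain ⟨φ, h1, h2⟩ := ha x
    exact ⟨.neg φ, h1, fun f v => not_congr (h2 f v)⟩
  | untl a b I ha hb =>
    obtain ⟨φ, h1, h2⟩ := ha (x + 2)
    obtain ⟨ψ, h3, h4⟩ := hb (x + 1)
    obtain ⟨θ, h5, h6⟩ := I.exists_fo (P := P) x (x + 1)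
    refine ⟨.ex (x + 1) (.conj (.lt (x, 0) (x + 1, 0)) (.conj θ (.conj ψ
      (.neg (.guard (x, 0) (x + 1, 0) (x + 2) (.neg φ)))))), ?_, fun f v => ?_⟩
    · simp only [FO.free, FO.guard]
      grind
    · simp [FO.sat, FO.guard, MTL.sat, Term.val, h2, h4, h6]
  | sinc a b I ha hb =>
    obtain ⟨φ, h1, h2⟩ := ha (x + 2)
    obtain ⟨ψ, h3, h4⟩ := hb (x + 1)
    obtain ⟨θ, h5, h6⟩ := I.exists_fo (P := P) (x + 1) x
    refine ⟨.ex (x + 1) (.conj (.lt (x + 1, 0) (x, 0)) (.conj θ (.conj ψ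
      (.neg (.guard (x + 1, 0) (x, 0) (x + 2) (.neg φ)))))), ?_, fun f v => ?_⟩
    · simp only [FO.free, FO.guard]
      grind
    · simp [FO.sat, FO.guard, MTL.sat, Term.val, h2, h4, h6]

/-! ### Non-dense groups of constants -/

theorem exists_eq_nat_mul {g : ℝ} (hg : g ∈ K) (hg0 : 0 < g)
    (hK : ∀ k ∈ K, 0 < k → g ≤ k) {k : ℝ} (hk : k ∈ K) (hk0 : 0 ≤ k) : ∃ m : ℕ, k = m * g := by
  refine ⟨⌊k / g⌋₊, ?_⟩
  have hmem : k - ⌊k / g⌋₊ * g ∈ K :=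
    sub_mem hk (by simpa using nsmul_mem hg ⌊k / g⌋₊)
  have h1 : ⌊k / g⌋₊ * g ≤ k := (le_div_iff₀ hg0).1 (Nat.floor_le (by positivity))
  have h2 : k < (⌊k / g⌋₊ + 1) * g := (div_lt_iff₀ hg0).1 (Nat.lt_floor_add_one _)
  by_contra h
  have := hK _ hmem (sub_pos.2 (lt_of_le_of_ne h1 (Ne.symm h)))
  linarith

/-- If `g` is the least positive constant, every interval is empty, or contains all of `(0, g)`,
or is a positive multiple of `g`, or lies above `g` and has length at least `g`. -/
theorem MTLI.cases_of_least (I : MTLI K) {g : ℝ} (hg : g ∈ K) (hg0 : 0 < g)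
    (hK : ∀ k ∈ K, 0 < k → g ≤ k) :
    (∀ t, 0 < t → ¬ I.mem t) ∨ (∀ t, 0 < t → t < g → I.mem t) ∨
      (∃ m : ℕ, 0 < m ∧ ∀ t, I.mem t ↔ t = m * g) ∨
      (∀ t, I.mem t → g ≤ t) ∧ ∃ a, ∀ t, a < t → t < a + g → I.mem t := by
  obtain ⟨lo, lo_mem, lo_nonneg, loClosed, hi, hi_mem, hiClosed, pos⟩ := I
  have hge : ∀ m : ℕ, 0 < m → g ≤ m * g := fun m hm =>
    le_mul_of_one_le_left hg0.le (by exact_mod_cast hm)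
  obtain ⟨m, rfl⟩ := exists_eq_nat_mul hg hg0 hK lo_mem lo_nonneg
  rcases hi with _ | h
  · rcases Nat.eq_zero_or_pos m with rfl | hm
    · right; left
      intro t ht _
      simp [mem, pos (by simp), ht]
    · right; right; right
      refine ⟨fun t ht => (hge m hm).trans ?_, m * g, fun t ht _ => ?_⟩
      · simp only [mem] at ht
        split_ifs at ht <;> linarith [ht.1]
      · simp only [mem]
        split_ifs <;> simp [ht, ht.le]
  · obtain ⟨hhK, hh0⟩ := hi_mem h rfl
    obtain ⟨k, rfl⟩ := exists_eq_nat_mul hg hg0 hK hhK hh0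
    simp only [mem, Option.some.injEq, forall_eq']
    rcases lt_trichotomy k m with hkm | rfl | hkm
    · left
      intro t ht h
      have : (k : ℝ) * g < m * g := by gcongr
      split_ifs at h <;> linarith [h.1, h.2]
    · rcases Nat.eq_zero_or_pos k with rfl | hm
      · left
        intro t ht h
        simp only [Nat.cast_zero, zero_mul] at h
        split_ifs at h <;> linarith [h.2]
      · cases loClosed <;> cases hiClosed
        · left
          intro t ht h
          simp at h
          linarith [h.1, h.2]
        · left
          intro t ht h
          simp at h
          linarith [h.1, h.2]
        · left
          intro t ht h
          simp at h
          linarith [h.1, h.2]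
        · right; right; left
          refine ⟨k, hm, fun t => ?_⟩
          simp only [if_true]
          exact ⟨fun h => le_antisymm h.2 h.1, fun h => ⟨h.ge, h.le⟩⟩
    · have hlt : (m : ℝ) * g + g ≤ k * g := by
        have : (m : ℝ) + 1 ≤ k := by exact_mod_cast hkm
        nlinarith
      rcases Nat.eq_zero_or_pos m with rfl | hm
      · right; left
        intro t ht htg
        have := pos (by simp)
        subst this
        have : t < k * g := by simp at hlt; linarith
        simp [ht, this, this.le]
      · right; right; right
        refine ⟨fun t ht => (hge m hm).trans ?_, m * g, fun t ht ht' => ?_⟩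
        · split_ifs at ht <;> linarith [ht.1]
        · have := ht'.trans_le hlt
          split_ifs <;> simp [ht, ht.le, this, this.le]

/-- Evaluated on a predicate of period `g / n`, where `n ≥ 2`, the until operator is insensitive
to `n` up to scaling. -/
theorem exists_periodic_until {g : ℝ} (hg : g ∈ K) (hg0 : 0 < g)
    (hK : ∀ k ∈ K, 0 < k → g ≤ k) (I : MTLI K) {A B : ℝ → Prop} (hA : A.Periodic 1)
    (hB : B.Periodic 1) :
    ∃ Q : ℝ → Prop, Q.Periodic 1 ∧ ∀ n : ℕ, 2 ≤ n → ∀ x,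
      (∃ t, x < t ∧ I.mem ((t - x) / n * g) ∧ B t ∧ ∀ u, x < u → u < t → A u) ↔ Q x := by
  have hall : ∀ {x t : ℝ}, x + 1 < t → (∀ u, x < u → u < t → A u) → ∀ u, A u := by
    intro x t hxt h u
    obtain ⟨w, hw, hwu⟩ := hA.exists_mem_Ioc one_pos u x
    rw [hwu]
    exact h w hw.1 (hw.2.trans_lt hxt)
  have hlong : ∀ {n : ℕ} {x t : ℝ}, 2 ≤ n → g ≤ (t - x) / n * g → x + 1 < t := by
    intro n x t hn h
    have hn' : (2 : ℝ) ≤ n := by exact_mod_cast hn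
    have h1 : 1 ≤ (t - x) / n := le_of_mul_le_mul_right (by simpa using h) hg0
    rw [le_div_iff₀ (by linarith)] at h1
    linarith
  rcases I.cases_of_least hg hg0 hK with h | h | ⟨m, hm, h⟩ | ⟨h, a, ha⟩
  · refine ⟨fun _ => False, fun _ => rfl, fun n hn x => ?_⟩
    simp only [iff_false]
    rintro ⟨t, hxt, ht, -⟩
    have : (0 : ℝ) < n := by exact_mod_cast (by omega : 0 < n)
    have : 0 < t - x := sub_pos.2 hxt
    exact h _ (by positivity) ht
  · refine ⟨fun x => ∃ t, x < t ∧ B t ∧ ∀ u, x < u → u < t → A u, fun x => propext ⟨?_, ?_⟩,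
      fun n hn x => ⟨?_, ?_⟩⟩
    · rintro ⟨t, h1, h2, h3⟩
      refine ⟨t - 1, by linarith, by rwa [hB.sub_eq], fun u hu hu' => ?_⟩
      rw [← hA u]
      exact h3 _ (by linarith) (by linarith)
    · rintro ⟨t, h1, h2, h3⟩
      refine ⟨t + 1, by linarith, by rwa [hB], fun u hu hu' => ?_⟩
      rw [← hA.sub_eq u]
      exact h3 _ (by linarith) (by linarith)
    · rintro ⟨t, h1, -, h2, h3⟩
      exact ⟨t, h1, h2, h3⟩
    · rintro ⟨t, h1, h2, h3⟩
      have hn' : (2 : ℝ) ≤ n := by exact_mod_cast hn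
      obtain ⟨w, hw, hwt⟩ := hB.exists_mem_Ioc one_pos t x
      have key : ∀ s, x < s → s ≤ x + 1 → I.mem ((s - x) / n * g) := fun s hs hs' => by
        have : 0 < s - x := sub_pos.2 hs
        refine h _ (by positivity) (mul_lt_of_lt_one_left hg0 ?_)
        rw [div_lt_one (by linarith)]
        linarith
      rcases le_or_gt t (x + 1) with ht | ht
      · exact ⟨t, h1, key t h1 ht, h2, h3⟩
      · exact ⟨w, hw.1, key w hw.1 hw.2, hwt ▸ h2, fun u hu hu' => hall ht h3 u⟩
  · refine ⟨fun x => B x ∧ ∀ u, A u, fun x => by simp only [hB x], fun n hn x => ?_⟩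
    have hn' : (0 : ℝ) < n := by exact_mod_cast (by omega : 0 < n)
    have hBx : B (x + (m * n : ℕ)) = B x := by
      simpa using hB.nat_mul (m * n) x
    have hmem : I.mem ((x + (m * n : ℕ) - x) / n * g) :=
      (h _).2 (by push_cast; field_simp; ring)
    constructor
    · rintro ⟨t, h1, h2, h3, h4⟩
      have ht : t = x + (m * n : ℕ) := by
        have := mul_right_cancel₀ hg0.ne' ((h _).1 h2)
        rw [div_eq_iff hn'.ne'] at this
        push_cast
        linarith
      refine ⟨hBx ▸ ht ▸ h3, hall (hlong hn ?_) h4⟩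
      rw [(h _).1 h2]
      exact le_mul_of_one_le_left hg0.le (by exact_mod_cast hm)
    · rintro ⟨h1, h2⟩
      refine ⟨x + (m * n : ℕ), ?_, hmem, hBx.symm ▸ h1, fun u _ _ => h2 u⟩
      have : 0 < m * n := Nat.mul_pos hm (by omega)
      exact lt_add_of_pos_right x (by exact_mod_cast this)
  · refine ⟨fun _ => (∃ t, B t) ∧ ∀ u, A u, fun _ => rfl, fun n hn x => ⟨?_, ?_⟩⟩
    · rintro ⟨t, h1, h2, h3, h4⟩
      exact ⟨⟨t, h3⟩, hall (hlong hn (h _ h2)) h4⟩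
    · rintro ⟨⟨t, ht⟩, hu⟩
      have hn' : (2 : ℝ) ≤ n := by exact_mod_cast hn
      obtain ⟨w, hw, hwt⟩ := hB.exists_mem_Ioc one_pos t (x + a / g * n)
      have hmem : I.mem ((w - x) / n * g) := by
        have hw1 : a / g < (w - x) / n := by
          rw [lt_div_iff₀ (by linarith)]
          linarith [hw.1]
        have hw2 : (w - x) / n < a / g + 1 := by
          rw [div_lt_iff₀ (by linarith)]
          linarith [hw.2]
        refine ha _ ((div_lt_iff₀ hg0).1 hw1) ?_
        calc (w - x) / n * g < (a / g + 1) * g := by gcongr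
          _ = a + g := by field_simp
      refine ⟨w, ?_, hmem, hwt ▸ ht, fun u _ _ => hu u⟩
      by_contra hwx
      have := h _ hmem
      have : (w - x) / n ≤ 0 := div_nonpos_of_nonpos_of_nonneg (by linarith) (by linarith)
      nlinarith

/-- The signal in which the proposition `0` holds at the multiples of `g / n`. -/
def combSignal (g : ℝ) (n : ℕ) : ℝ → Set ℕ := fun t => {p | p = 0 ∧ ∃ k : ℤ, t / g * n = k}

theorem exists_periodic_sat_combSignal {g : ℝ} (hg : g ∈ K) (hg0 : 0 < g)
    (hK : ∀ k ∈ K, 0 < k → g ≤ k) (φ : MTL K ℕ) :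
    ∃ Q : ℝ → Prop, Q.Periodic 1 ∧ ∀ n : ℕ, 2 ≤ n → ∀ x,
      φ.sat (combSignal g n) (x / n * g) ↔ Q x := by
  have hcancel : ∀ {n : ℕ}, 2 ≤ n → ∀ x : ℝ, x / n * g / g * n = x := fun {n} hn x => by
    have : (n : ℝ) ≠ 0 := by exact_mod_cast (by omega : n ≠ 0)
    field_simp
  have hlt : ∀ {n : ℕ}, 2 ≤ n → ∀ {x y : ℝ}, x / n * g < y / n * g ↔ x < y := fun {n} hn x y => by
    have : (0 : ℝ) < n := by exact_mod_cast (by omega : 0 < n)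
    rw [mul_lt_mul_iff_left₀ hg0, div_lt_div_iff_of_pos_right this]
  have hsurj : ∀ {n : ℕ}, 2 ≤ n → Function.Surjective fun x : ℝ => x / n * g :=
    fun {n} hn y => ⟨y / g * n, by
      have : (n : ℝ) ≠ 0 := by exact_mod_cast (by omega : n ≠ 0)
      simp only
      field_simp⟩
  have hsub : ∀ (n : ℕ) (x y : ℝ), x / n * g - y / n * g = (x - y) / n * g := fun n x y => by
    rw [sub_div, sub_mul]
  induction φ with
  | tt => exact ⟨fun _ => True, fun _ => rfl, fun n hn x => Iff.rfl⟩
  | atom p =>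
    refine ⟨fun x => p = 0 ∧ ∃ k : ℤ, x = k, fun x => ?_, fun n hn x => ?_⟩
    · refine congrArg _ (propext ⟨?_, ?_⟩)
      · rintro ⟨k, hk⟩
        exact ⟨k - 1, by push_cast; linarith⟩
      · rintro ⟨k, hk⟩
        exact ⟨k + 1, by push_cast; linarith⟩
    · simp only [MTL.sat, combSignal, Set.mem_ofPred_eq, hcancel hn]
  | conj a b ha hb =>
    obtain ⟨A, hA, hA'⟩ := ha
    obtain ⟨B, hB, hB'⟩ := hb
    exact ⟨fun x => A x ∧ B x, fun x => by simp only [hA x, hB x],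
      fun n hn x => and_congr (hA' n hn x) (hB' n hn x)⟩
  | neg a ha =>
    obtain ⟨A, hA, hA'⟩ := ha
    exact ⟨fun x => ¬ A x, fun x => by simp only [hA x], fun n hn x => not_congr (hA' n hn x)⟩
  | untl a b I ha hb =>
    obtain ⟨A, hA, hA'⟩ := ha
    obtain ⟨B, hB, hB'⟩ := hb
    obtain ⟨Q, hQ, hQ'⟩ := exists_periodic_until hg hg0 hK I hA hB
    refine ⟨Q, hQ, fun n hn x => ?_⟩
    rw [MTL.sat, (hsurj hn).exists, ← hQ' n hn]
    refine exists_congr fun t => ?_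
    rw [(hsurj hn).forall]
    simp only [hlt hn, hA' n hn, hB' n hn, hsub]
  | sinc a b I ha hb =>
    obtain ⟨A, hA, hA'⟩ := ha
    obtain ⟨B, hB, hB'⟩ := hb
    have hneg : ∀ {A : ℝ → Prop}, A.Periodic 1 → (fun x => A (-x)).Periodic 1 := fun {A} hA x => by
      simp only [neg_add, ← sub_eq_add_neg, hA.sub_eq]
    obtain ⟨Q, hQ, hQ'⟩ := exists_periodic_until hg hg0 hK I (hneg hA) (hneg hB)
    refine ⟨fun x => Q (-x), hneg hQ, fun n hn x => ?_⟩
    refine Iff.trans ?_ (hQ' n hn (-x))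
    rw [MTL.sat, (hsurj hn).exists, ← (Equiv.neg ℝ).exists_congr_right]
    refine exists_congr fun t => ?_
    rw [(hsurj hn).forall]
    simp only [hlt hn, hA' n hn, hB' n hn, hsub, Equiv.neg_apply, forall_neg_Ioo, neg_neg]
    rw [neg_lt, show x - -t = t - -x by ring]

theorem not_exists_mtl_of_least {g : ℝ} (hg : g ∈ K) (hg0 : 0 < g)
    (hK : ∀ k ∈ K, 0 < k → g ≤ k) :
    ∃ φ : FO K ℕ, φ.free ⊆ {0} ∧ ¬ ∃ ψ : MTL K ℕ, EquivFOMTL φ ψ := by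
  refine ⟨.guard (0, 0) (0, ⟨g, hg⟩) 1 (.conj (.atom 0 (1, 0))
    (.guard (1, 0) (0, ⟨g, hg⟩) 2 (.atom 0 (2, 0)))), ?_, ?_⟩
  · simp only [FO.free, FO.guard]
    grind
  · rintro ⟨ψ, hψ⟩
    obtain ⟨Q, -, hQ⟩ := exists_periodic_sat_combSignal hg hg0 hK ψ
    have hsat : ∀ n : ℕ, 2 ≤ n → ((∃ r, (0 < r ∧ r < g) ∧ (∃ k : ℤ, r / g * n = k) ∧
        ∃ s, (r < s ∧ s < g) ∧ ∃ k : ℤ, s / g * n = k) ↔ Q 0) := fun n hn => by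
      rw [← hQ n hn 0, zero_div, zero_mul, ← hψ]
      simp [FO.sat, FO.guard, Term.val, combSignal]
    have h3 := (hsat 3 (by norm_num)).1 ⟨g / 3, ⟨by linarith, by linarith⟩,
      ⟨1, by push_cast; field_simp⟩, 2 * g / 3, ⟨by linarith, by linarith⟩,
      2, by push_cast; field_simp⟩
    obtain ⟨r, ⟨h0, -⟩, ⟨k, hk⟩, s, ⟨h1, h2⟩, l, hl⟩ := (hsat 2 le_rfl).2 h3
    have hr : 0 < r / g := by positivity
    have hrs : r / g < s / g := by gcongr
    have hs : s / g < 1 := (div_lt_one hg0).2 h2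
    push_cast at hk hl
    have hk0 : 0 < k := by exact_mod_cast (by linarith : (0 : ℝ) < k)
    have hkl : k < l := by exact_mod_cast (by linarith : (k : ℝ) < l)
    have hl2 : l < 2 := by exact_mod_cast (by linarith : (l : ℝ) < 2)
    omega

theorem exists_least_of_not_denseK (h : ¬ DenseK K) :
    ∃ g ∈ K, 0 < g ∧ ∀ k ∈ K, 0 < k → g ≤ k := by
  simp only [DenseK] at h
  push Not at h
  obtain ⟨a, ha, b, hb, hab, h⟩ := h
  refine ⟨b - a, sub_mem hb ha, sub_pos.2 hab, fun k hk hk0 => ?_⟩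
  have := h (a + k) (add_mem ha hk) (by linarith)
  linarith

/-- **Theorem 1.** Let `K` be an additive subgroup of `ℝ`.  Then `MTL_K` and `FO_K` have the
same expressive power if and only if `K` is dense. -/
theorem mtl_eq_fo_iff_dense (K : AddSubgroup ℝ) :
    SameExpressive K ℕ ↔ DenseK K := by
  refine ⟨fun h => ?_, fun hK => ⟨fun φ _ => φ.exists_mtl hK, fun ψ => ?_⟩⟩
  · by_contra hK
    obtain ⟨g, hg, hg0, hmin⟩ := exists_least_of_not_denseK hK
    obtain ⟨φ, hφ, hne⟩ := not_exists_mtl_of_least hg hg0 hmin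
    exact hne (h.1 φ hφ)
  · obtain ⟨φ, h1, h2⟩ := ψ.exists_fo 0
    exact ⟨φ, h1, fun f r => h2 f fun _ => r⟩

end MTLPaper
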